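/- arXiv:1609.00482 — 2 statements merged into one kernel-verified Lean document; each statement's English description precedes it below -/
import Mathlib

section
/- Let α ∈ [1/2, 1). Let ρ₁, ρ₂ be density matrices on ℂ^n, let ξ₁, ξ₂ be density matrices on ℂ^m, and let U be a unitary complex matrix with rows and columns indexed by Fin n × Fin m. For i = 1, 2 define the induced channel E_i(ρ) = Tr₂(U (ρ ⊗ ξ_i) U*). Then F_α(ρ₁, ρ₂) · F_α(ξ₁, ξ₂) ≤ F_α(E₁(ρ₁), E₂(ρ₂)). -/
open Matrix
open scoped Kronecker ComplexOrder

/-- Real power of a (Hermitian) matrix, defined by applying the real power function to the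
eigenvalues via the spectral decomposition (functional calculus). -/
noncomputable def mpow {ι : Type*} [Fintype ι] [DecidableEq ι]
    (A : Matrix ι ι ℂ) (t : ℝ) : Matrix ι ι ℂ :=
  if hA : A.IsHermitian then
    (hA.eigenvectorUnitary : Matrix ι ι ℂ) *
      Matrix.diagonal (fun i => ((hA.eigenvalues i ^ t : ℝ) : ℂ)) *
      star (hA.eigenvectorUnitary : Matrix ι ι ℂ)
  else 0

/-- The α-fidelity `F_α(ρ,σ) = tr[(σ^((1−α)/(2α)) ρ σ^((1−α)/(2α)))^α]`. -/
noncomputable def aFid {ι : Type*} [Fintype ι] [DecidableEq ι]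
    (α : ℝ) (ρ σ : Matrix ι ι ℂ) : ℝ :=
  (Matrix.trace (mpow (mpow σ ((1 - α) / (2 * α)) * ρ * mpow σ ((1 - α) / (2 * α))) α)).re

/-- A density matrix: positive semidefinite with trace 1. -/
def IsDensity {ι : Type*} [Fintype ι] (ρ : Matrix ι ι ℂ) : Prop :=
  ρ.PosSemidef ∧ ρ.trace = 1

/-- Partial trace over the second tensor factor. -/
noncomputable def ptrace2 {ι κ : Type*} [Fintype κ]
    (M : Matrix (ι × κ) (ι × κ) ℂ) : Matrix ι ι ℂ :=
  Matrix.of fun i j => ∑ k : κ, M (i, k) (j, k)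

/-- A quantum channel: a map admitting a Kraus representation `E(X) = Σ_i K_i X K_i*`
with `Σ_i K_i* K_i = 1`. -/
def IsQChannel {ι κ : Type*} [Fintype ι] [DecidableEq ι] [Fintype κ] [DecidableEq κ]
    (E : Matrix ι ι ℂ → Matrix κ κ ℂ) : Prop :=
  ∃ (k : ℕ) (K : Fin k → Matrix κ ι ℂ),
    (∀ X, E X = ∑ i, K i * X * (K i)ᴴ) ∧ (∑ i, (K i)ᴴ * K i = 1)

/-- The α-fidelity of channels:
`𝓕_α(E₁,E₂) = inf { F_α(E₁(ρ₁),E₂(ρ₂)) / F_α(ρ₁,ρ₂) }` over density matrices with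
`F_α(ρ₁,ρ₂) > 0`. -/
noncomputable def chanFid {ι κ : Type*} [Fintype ι] [DecidableEq ι] [Fintype κ] [DecidableEq κ]
    (α : ℝ) (E₁ E₂ : Matrix ι ι ℂ → Matrix κ κ ℂ) : ℝ :=
  sInf { r : ℝ | ∃ ρ₁ ρ₂ : Matrix ι ι ℂ, IsDensity ρ₁ ∧ IsDensity ρ₂ ∧
    0 < aFid α ρ₁ ρ₂ ∧ r = aFid α (E₁ ρ₁) (E₂ ρ₂) / aFid α ρ₁ ρ₂ }

section HermitianFunction

variable {ι κ : Type*} [Fintype ι] [DecidableEq ι] [Fintype κ] [DecidableEq κ]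

/-- The function `f` applied to the eigenvalues of the Hermitian matrix `A`
(zero if `A` is not Hermitian). -/
noncomputable def hermFun (A : Matrix ι ι ℂ) (f : ℝ → ℂ) : Matrix ι ι ℂ :=
  if hA : A.IsHermitian then
    (hA.eigenvectorUnitary : Matrix ι ι ℂ) *
      Matrix.diagonal (fun i => f (hA.eigenvalues i)) *
      star (hA.eigenvectorUnitary : Matrix ι ι ℂ)
  else 0

theorem hermFun_of_isHermitian {A : Matrix ι ι ℂ} (hA : A.IsHermitian) (f : ℝ → ℂ) :
    hermFun A f = (hA.eigenvectorUnitary : Matrix ι ι ℂ) *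
      Matrix.diagonal (fun i => f (hA.eigenvalues i)) *
      star (hA.eigenvectorUnitary : Matrix ι ι ℂ) := dif_pos hA

theorem mpow_eq_hermFun (A : Matrix ι ι ℂ) (t : ℝ) :
    mpow A t = hermFun A (fun x => ((x ^ t : ℝ) : ℂ)) := rfl

theorem Matrix.IsHermitian.eq_conj_diagonal {A : Matrix ι ι ℂ} (hA : A.IsHermitian) :
    A = (hA.eigenvectorUnitary : Matrix ι ι ℂ) *
      Matrix.diagonal (fun i => (hA.eigenvalues i : ℂ)) *
      star (hA.eigenvectorUnitary : Matrix ι ι ℂ) := by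
  conv_lhs => rw [hA.spectral_theorem, Unitary.conjStarAlgAut_apply]
  rfl

/-- `hermFun` may be computed from any unitary diagonalization. -/
theorem hermFun_conj_diagonal {V : Matrix ι ι ℂ} (hV : V ∈ unitaryGroup ι ℂ) (d : ι → ℝ)
    (f : ℝ → ℂ) :
    hermFun (V * diagonal (fun i => (d i : ℂ)) * star V) f =
      V * diagonal (fun i => f (d i)) * star V := by
  have hA : (V * diagonal (fun i => (d i : ℂ)) * star V).IsHermitian := by
    simp only [IsHermitian, star_eq_conjTranspose, conjTranspose_mul, conjTranspose_conjTranspose,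
      diagonal_conjTranspose, mul_assoc]
    congr 3
    ext i
    simp
  have hW := hA.eq_conj_diagonal
  rw [hermFun, dif_pos hA]
  set W : Matrix ι ι ℂ := (hA.eigenvectorUnitary : Matrix ι ι ℂ) with hWdef
  have hWu : W ∈ unitaryGroup ι ℂ := hA.eigenvectorUnitary.2
  set e := hA.eigenvalues
  have hV1 := mem_unitaryGroup_iff'.1 hV
  have hV2 := mem_unitaryGroup_iff.1 hV
  have hW1 := mem_unitaryGroup_iff'.1 hWu
  have hW2 := mem_unitaryGroup_iff.1 hWu
  have key : (star W * V) * diagonal (fun i => (d i : ℂ)) =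
      diagonal (fun i => (e i : ℂ)) * (star W * V) := by
    calc _ = star W * (V * diagonal (fun i => (d i : ℂ)) * star V) * V := by
          simp only [mul_assoc, hV1, mul_one]
      _ = _ := by
          rw [hW]
          simp only [← mul_assoc, hW1, one_mul]
  have key' : (star W * V) * diagonal (fun i => f (d i)) =
      diagonal (fun i => f (e i)) * (star W * V) := by
    ext i j
    have h := congrFun (congrFun key i) j
    simp only [mul_diagonal, diagonal_mul] at h ⊢
    by_cases hz : (star W * V) i j = 0
    · simp [hz]
    · rw [mul_comm] at h
      have : d j = e i := by exact_mod_cast mul_right_cancel₀ hz h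
      rw [this, mul_comm]
  calc W * diagonal (fun i => f (e i)) * star W
      = W * (diagonal (fun i => f (e i)) * (star W * V)) * star V := by
        simp only [mul_assoc, hV2, mul_one]
    _ = V * diagonal (fun i => f (d i)) * star V := by
        rw [← key']
        simp only [← mul_assoc, hW2, one_mul]

theorem hermFun_mul (A : Matrix ι ι ℂ) (f g : ℝ → ℂ) :
    hermFun A f * hermFun A g = hermFun A (fun x => f x * g x) := by
  unfold hermFun
  split_ifs with hA
  · have h := mem_unitaryGroup_iff'.1 hA.eigenvectorUnitary.2
    have := diagonal_mul_diagonal (fun i => f (hA.eigenvalues i)) (fun i => g (hA.eigenvalues i))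
    rw [← this]
    simp only [mul_assoc]
    congr 2
    simp only [← mul_assoc, h, one_mul]
  · simp

theorem hermFun_conjTranspose (A : Matrix ι ι ℂ) (f : ℝ → ℂ) :
    (hermFun A f)ᴴ = hermFun A (fun x => star (f x)) := by
  unfold hermFun
  split_ifs with hA
  · simp only [star_eq_conjTranspose, conjTranspose_mul, conjTranspose_conjTranspose,
      diagonal_conjTranspose, mul_assoc]
    rfl
  · simp

theorem hermFun_congr {A : Matrix ι ι ℂ} (hA : A.PosSemidef) {f g : ℝ → ℂ}
    (h : ∀ x, 0 ≤ x → f x = g x) : hermFun A f = hermFun A g := by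
  unfold hermFun
  rw [dif_pos hA.1, dif_pos hA.1]
  simp only [h _ (hA.eigenvalues_nonneg _)]

theorem hermFun_id {A : Matrix ι ι ℂ} (hA : A.IsHermitian) :
    hermFun A (fun x => (x : ℂ)) = A := by
  rw [hermFun, dif_pos hA, ← hA.eq_conj_diagonal]

theorem one_sub_hermFun {A : Matrix ι ι ℂ} (hA : A.IsHermitian) (f : ℝ → ℂ) :
    1 - hermFun A f = hermFun A (fun x => 1 - f x) := by
  have h := mem_unitaryGroup_iff.1 hA.eigenvectorUnitary.2
  have h1 := diagonal_sub (fun _ => (1 : ℂ)) (fun i => f (hA.eigenvalues i))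
  rw [hermFun, hermFun, dif_pos hA, dif_pos hA, ← h1, mul_sub, sub_mul]
  simp [h]

theorem hermFun_posSemidef {A : Matrix ι ι ℂ} {f : ℝ → ℂ} (hf : ∀ x, 0 ≤ f x) :
    (hermFun A f).PosSemidef := by
  unfold hermFun
  split_ifs with hA
  · exact (PosSemidef.diagonal fun i => hf _).mul_mul_conjTranspose_same _
  · exact PosSemidef.zero

theorem hermFun_conj {V : Matrix ι ι ℂ} (hV : V ∈ unitaryGroup ι ℂ) {A : Matrix ι ι ℂ}
    (hA : A.IsHermitian) (f : ℝ → ℂ) :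
    hermFun (V * A * Vᴴ) f = V * hermFun A f * Vᴴ := by
  set W : Matrix ι ι ℂ := (hA.eigenvectorUnitary : Matrix ι ι ℂ) with hWdef
  have hWu : W ∈ unitaryGroup ι ℂ := hA.eigenvectorUnitary.2
  have h := hermFun_conj_diagonal (mul_mem hV hWu) hA.eigenvalues f
  rw [hermFun_of_isHermitian hA, ← hWdef]
  conv_lhs => rw [hA.eq_conj_diagonal, ← hWdef]
  simpa only [star_mul, mul_assoc, star_eq_conjTranspose] using h

theorem hermFun_kronecker {A : Matrix ι ι ℂ} {B : Matrix κ κ ℂ} (hA : A.PosSemidef)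
    (hB : B.PosSemidef) {f : ℝ → ℂ} (hf : ∀ x y, 0 ≤ x → 0 ≤ y → f (x * y) = f x * f y) :
    hermFun (A ⊗ₖ B) f = hermFun A f ⊗ₖ hermFun B f := by
  set V : Matrix ι ι ℂ := (hA.1.eigenvectorUnitary : Matrix ι ι ℂ) with hV
  set W : Matrix κ κ ℂ := (hB.1.eigenvectorUnitary : Matrix κ κ ℂ) with hW
  have hVu : V ∈ unitaryGroup ι ℂ := hA.1.eigenvectorUnitary.2
  have hWu : W ∈ unitaryGroup κ ℂ := hB.1.eigenvectorUnitary.2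
  have hVW : V ⊗ₖ W ∈ unitaryGroup (ι × κ) ℂ := kronecker_mem_unitary hVu hWu
  have h := hermFun_conj_diagonal hVW
    (fun p => hA.1.eigenvalues p.1 * hB.1.eigenvalues p.2) f
  have key : ∀ (a : ι → ℂ) (b : κ → ℂ), (V ⊗ₖ W) * diagonal (fun p : ι × κ => a p.1 * b p.2) *
      star (V ⊗ₖ W) = (V * diagonal a * star V) ⊗ₖ (W * diagonal b * star W) := by
    intro a b
    rw [mul_kronecker_mul, mul_kronecker_mul, diagonal_kronecker_diagonal, star_eq_conjTranspose,
      conjTranspose_kronecker]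
    rfl
  rw [hermFun_of_isHermitian hA.1, hermFun_of_isHermitian hB.1, ← hV, ← hW, ← key]
  conv_lhs => rw [hA.1.eq_conj_diagonal, hB.1.eq_conj_diagonal, ← hV, ← hW, ← key]
  simp only [Complex.ofReal_mul] at h
  rw [h]
  simp only [hf _ _ (hA.eigenvalues_nonneg _) (hB.eigenvalues_nonneg _)]

end HermitianFunction

section AlphaFidelity

variable {ι κ : Type*} [Fintype ι] [DecidableEq ι] [Fintype κ] [DecidableEq κ]

theorem mpow_posSemidef {A : Matrix ι ι ℂ} (hA : A.PosSemidef) (t : ℝ) :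
    (mpow A t).PosSemidef := by
  rw [mpow_eq_hermFun, hermFun_of_isHermitian hA.1]
  refine (PosSemidef.diagonal fun i => ?_).mul_mul_conjTranspose_same _
  exact Complex.zero_le_real.2 (Real.rpow_nonneg (hA.eigenvalues_nonneg i) t)

theorem mpow_conj {V A : Matrix ι ι ℂ} (hV : V ∈ unitaryGroup ι ℂ) (hA : A.IsHermitian)
    (t : ℝ) : mpow (V * A * Vᴴ) t = V * mpow A t * Vᴴ := by
  rw [mpow_eq_hermFun, mpow_eq_hermFun, hermFun_conj hV hA]

theorem mpow_kronecker {A : Matrix ι ι ℂ} {B : Matrix κ κ ℂ} (hA : A.PosSemidef)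
    (hB : B.PosSemidef) (t : ℝ) : mpow (A ⊗ₖ B) t = mpow A t ⊗ₖ mpow B t := by
  simp only [mpow_eq_hermFun]
  refine hermFun_kronecker hA hB fun x y hx hy => ?_
  rw [Real.mul_rpow hx hy, Complex.ofReal_mul]

theorem sandwich_posSemidef {A B : Matrix ι ι ℂ} (hA : A.PosSemidef) (hB : B.PosSemidef)
    (t : ℝ) : (mpow B t * A * mpow B t).PosSemidef := by
  simpa only [(mpow_posSemidef hB t).1.eq] using
    hA.mul_mul_conjTranspose_same (mpow B t)

theorem aFid_conj {V A B : Matrix ι ι ℂ} (hV : V ∈ unitaryGroup ι ℂ) (hA : A.PosSemidef)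
    (hB : B.PosSemidef) (α : ℝ) : aFid α (V * A * Vᴴ) (V * B * Vᴴ) = aFid α A B := by
  have hV1 : Vᴴ * V = 1 := mem_unitaryGroup_iff'.1 hV
  unfold aFid
  set s := (1 - α) / (2 * α)
  have h : V * mpow B s * Vᴴ * (V * A * Vᴴ) * (V * mpow B s * Vᴴ) =
      V * (mpow B s * A * mpow B s) * Vᴴ := by
    calc _ = V * mpow B s * (Vᴴ * V) * A * (Vᴴ * V) * mpow B s * Vᴴ := by
          simp only [mul_assoc]
      _ = _ := by simp only [hV1, mul_one, mul_assoc]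
  rw [mpow_conj hV hB.1, h, mpow_conj hV (sandwich_posSemidef hA hB s).1, trace_mul_comm,
    ← mul_assoc, hV1, one_mul]

theorem trace_mpow {A : Matrix ι ι ℂ} (hA : A.IsHermitian) (t : ℝ) :
    (mpow A t).trace = ((∑ i, hA.eigenvalues i ^ t : ℝ) : ℂ) := by
  rw [mpow_eq_hermFun, hermFun_of_isHermitian hA, trace_mul_comm, ← mul_assoc,
    mem_unitaryGroup_iff'.1 hA.eigenvectorUnitary.2, one_mul, trace_diagonal]
  simp

theorem aFid_kronecker {A B : Matrix ι ι ℂ} {C D : Matrix κ κ ℂ} (hA : A.PosSemidef)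
    (hB : B.PosSemidef) (hC : C.PosSemidef) (hD : D.PosSemidef) (α : ℝ) :
    aFid α (A ⊗ₖ C) (B ⊗ₖ D) = aFid α A B * aFid α C D := by
  unfold aFid
  set s := (1 - α) / (2 * α)
  have h1 := sandwich_posSemidef hA hB s
  have h2 := sandwich_posSemidef hC hD s
  rw [mpow_kronecker hB hD, ← mul_kronecker_mul, ← mul_kronecker_mul, mpow_kronecker h1 h2,
    trace_kronecker, trace_mpow h1.1, trace_mpow h2.1, ← Complex.ofReal_mul]
  simp only [Complex.ofReal_re]

end AlphaFidelity

section HilbertSchmidt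

variable {ι κ : Type*} [Fintype ι] [Fintype κ]

/-- The squared Hilbert–Schmidt norm. -/
noncomputable def hsSq (M : Matrix ι κ ℂ) : ℝ := (Mᴴ * M).trace.re

theorem hsSq_eq_sum (M : Matrix ι κ ℂ) : hsSq M = ∑ p : ι × κ, ‖M p.1 p.2‖ ^ 2 := by
  simp only [hsSq, trace, diag_apply, mul_apply, conjTranspose_apply, Complex.re_sum,
    Fintype.sum_prod_type]
  rw [Finset.sum_comm]
  refine Finset.sum_congr rfl fun i _ => Finset.sum_congr rfl fun j _ => ?_
  rw [Complex.star_def, ← Complex.normSq_eq_conj_mul_self, Complex.ofReal_re,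
    Complex.normSq_eq_norm_sq]

theorem hsSq_conjTranspose (M : Matrix ι κ ℂ) : hsSq Mᴴ = hsSq M := by
  rw [hsSq, hsSq, conjTranspose_conjTranspose, trace_mul_comm]

theorem eq_zero_of_hsSq_eq_zero {M : Matrix ι κ ℂ} (h : hsSq M = 0) : M = 0 := by
  rw [hsSq_eq_sum, Finset.sum_eq_zero_iff_of_nonneg fun _ _ => by positivity] at h
  ext i j
  simpa using h (i, j) (Finset.mem_univ _)

theorem norm_trace_mul_le (A : Matrix ι κ ℂ) (B : Matrix κ ι ℂ) :
    ‖(A * B).trace‖ ≤ √(hsSq A) * √(hsSq B) := by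
  rw [← hsSq_conjTranspose B, hsSq_eq_sum, hsSq_eq_sum]
  calc ‖(A * B).trace‖ = ‖∑ p : ι × κ, A p.1 p.2 * B p.2 p.1‖ := by
        simp only [trace, diag_apply, mul_apply, Fintype.sum_prod_type]
    _ ≤ ∑ p : ι × κ, ‖A p.1 p.2‖ * ‖Bᴴ p.1 p.2‖ := by
        refine (norm_sum_le _ _).trans_eq (Finset.sum_congr rfl fun p _ => ?_)
        rw [norm_mul, conjTranspose_apply, norm_star]
    _ ≤ _ := Real.sum_mul_le_sqrt_mul_sqrt _ _ _

theorem hsSq_mul_le_left [DecidableEq ι] {W : Matrix ι ι ℂ} (hW : (1 - Wᴴ * W).PosSemidef)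
    (M : Matrix ι κ ℂ) :
    hsSq (W * M) ≤ hsSq M := by
  have h := (hW.conjTranspose_mul_mul_same M).trace_nonneg
  have h' := (Complex.le_def.1 h).1
  have e : (Mᴴ * (1 - Wᴴ * W) * M) = Mᴴ * M - (W * M)ᴴ * (W * M) := by
    rw [conjTranspose_mul]
    simp only [Matrix.mul_sub, Matrix.sub_mul, Matrix.mul_one, Matrix.mul_assoc]
  rw [e, trace_sub, Complex.sub_re, Complex.zero_re] at h'
  unfold hsSq
  linarith

theorem hsSq_mul_le_right [DecidableEq κ] {W : Matrix κ κ ℂ} (hW : (1 - W * Wᴴ).PosSemidef)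
    (M : Matrix ι κ ℂ) : hsSq (M * W) ≤ hsSq M := by
  rw [← hsSq_conjTranspose, ← hsSq_conjTranspose M, conjTranspose_mul]
  exact hsSq_mul_le_left (by rwa [conjTranspose_conjTranspose]) _

end HilbertSchmidt

section ComplexPower

variable {ι κ : Type*} [Fintype ι] [DecidableEq ι] [Fintype κ]

/-- The scalar power `x ^ z` for `0 < x`, set to `0` for `x = 0` and every exponent `z`. -/
noncomputable def suppPow (z : ℂ) (x : ℝ) : ℂ :=
  if x = 0 then 0 else Complex.exp (z * Real.log x)

/-- Complex power of a positive semidefinite matrix on its support. -/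
noncomputable def cpowSupp (A : Matrix ι ι ℂ) (z : ℂ) : Matrix ι ι ℂ :=
  hermFun A (suppPow z)

theorem suppPow_add (z w : ℂ) (x : ℝ) : suppPow z x * suppPow w x = suppPow (z + w) x := by
  unfold suppPow
  split_ifs
  · simp
  · rw [← Complex.exp_add, add_mul]

theorem star_suppPow (z : ℂ) (x : ℝ) : star (suppPow z x) = suppPow (star z) x := by
  unfold suppPow
  split_ifs
  · simp
  · simp [← Complex.exp_conj]

theorem suppPow_ofReal {t x : ℝ} (ht : t ≠ 0) (hx : 0 ≤ x) :
    suppPow t x = ((x ^ t : ℝ) : ℂ) := by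
  unfold suppPow
  split_ifs with h
  · simp [h, Real.zero_rpow ht]
  · rw [Real.rpow_def_of_pos (lt_of_le_of_ne hx (Ne.symm h)), Complex.ofReal_exp, mul_comm]
    simp

theorem cpowSupp_mul (A : Matrix ι ι ℂ) (z w : ℂ) :
    cpowSupp A z * cpowSupp A w = cpowSupp A (z + w) := by
  unfold cpowSupp
  rw [hermFun_mul]
  simp only [suppPow_add]

theorem cpowSupp_conjTranspose (A : Matrix ι ι ℂ) (z : ℂ) :
    (cpowSupp A z)ᴴ = cpowSupp A (star z) := by
  unfold cpowSupp
  rw [hermFun_conjTranspose]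
  simp only [star_suppPow]

theorem cpowSupp_ofReal {A : Matrix ι ι ℂ} (hA : A.PosSemidef) {t : ℝ} (ht : t ≠ 0) :
    cpowSupp A t = mpow A t := by
  rw [cpowSupp, mpow_eq_hermFun]
  exact hermFun_congr hA fun _ hx => suppPow_ofReal ht hx

theorem cpowSupp_one {A : Matrix ι ι ℂ} (hA : A.PosSemidef) : cpowSupp A 1 = A := by
  conv_rhs => rw [← hermFun_id hA.1]
  rw [cpowSupp]
  refine hermFun_congr hA fun x hx => ?_
  simpa using suppPow_ofReal one_ne_zero hx

theorem one_sub_cpowSupp_zero_posSemidef {A : Matrix ι ι ℂ} (hA : A.IsHermitian) :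
    (1 - cpowSupp A 0).PosSemidef := by
  unfold cpowSupp
  rw [one_sub_hermFun hA]
  refine hermFun_posSemidef fun x => ?_
  unfold suppPow
  split_ifs <;> simp

theorem one_sub_cpowSupp_conjTranspose_mul_self {A : Matrix ι ι ℂ} (hA : A.IsHermitian) {z : ℂ}
    (hz : z.re = 0) : (1 - (cpowSupp A z)ᴴ * cpowSupp A z).PosSemidef := by
  have : star z + z = 0 := by apply Complex.ext <;> simp [hz]
  rw [cpowSupp_conjTranspose, cpowSupp_mul, this]
  exact one_sub_cpowSupp_zero_posSemidef hA

theorem one_sub_cpowSupp_mul_conjTranspose {A : Matrix ι ι ℂ} (hA : A.IsHermitian) {z : ℂ}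
    (hz : z.re = 0) : (1 - cpowSupp A z * (cpowSupp A z)ᴴ).PosSemidef := by
  have : z + star z = 0 := by apply Complex.ext <;> simp [hz]
  rw [cpowSupp_conjTranspose, cpowSupp_mul, this]
  exact one_sub_cpowSupp_zero_posSemidef hA

theorem hsSq_cpowSupp_mul_le {A : Matrix ι ι ℂ} (hA : A.IsHermitian) {z : ℂ} (hz : z.re = 0)
    (M : Matrix ι κ ℂ) : hsSq (cpowSupp A z * M) ≤ hsSq M :=
  hsSq_mul_le_left (one_sub_cpowSupp_conjTranspose_mul_self hA hz) M

theorem hsSq_mul_cpowSupp_le {A : Matrix ι ι ℂ} (hA : A.IsHermitian) {z : ℂ} (hz : z.re = 0)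
    (M : Matrix κ ι ℂ) : hsSq (M * cpowSupp A z) ≤ hsSq M :=
  hsSq_mul_le_right (one_sub_cpowSupp_mul_conjTranspose hA hz) M

theorem hsSq_cpowSupp {A : Matrix ι ι ℂ} (hA : A.PosSemidef) {z : ℂ} {t : ℝ} (ht : t ≠ 0)
    (hz : 2 * z.re = t) : hsSq (cpowSupp A z) = (mpow A t).trace.re := by
  have : star z + z = (t : ℂ) := by
    apply Complex.ext
    · simp; linarith
    · simp
  rw [hsSq, cpowSupp_conjTranspose, cpowSupp_mul, this, cpowSupp_ofReal hA ht]

/-- A matrix `N` is supported on the support of `Nᴴ * N`. -/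
theorem mul_cpowSupp_zero (N : Matrix κ ι ℂ) : N * cpowSupp (Nᴴ * N) 0 = N := by
  have hD : (Nᴴ * N).PosSemidef := posSemidef_conjTranspose_mul_self N
  refine (sub_eq_zero.1 (eq_zero_of_hsSq_eq_zero ?_)).symm
  set D := Nᴴ * N with hDdef
  have h1 : D * cpowSupp D 0 = D := by
    conv_lhs => enter [1]; rw [← cpowSupp_one hD]
    rw [cpowSupp_mul, add_zero, cpowSupp_one hD]
  have h2 : (N - N * cpowSupp D 0)ᴴ * (N - N * cpowSupp D 0) =
      (D - D * cpowSupp D 0) - (cpowSupp D 0)ᴴ * (D - D * cpowSupp D 0) := by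
    simp only [conjTranspose_sub, conjTranspose_mul, Matrix.sub_mul, Matrix.mul_sub, hDdef,
      Matrix.mul_assoc]
    abel
  rw [hsSq, h2, h1]
  simp

end ComplexPower

section Strip

variable {ι κ μ : Type*}

/-- Entire matrix-valued functions bounded on the strip `0 ≤ re z ≤ 1`, entrywise. -/
def StripBounded (M : ℂ → Matrix ι κ ℂ) : Prop :=
  ∀ i j, Differentiable ℂ (fun z => M z i j) ∧
    ∃ C : ℝ, ∀ z : ℂ, 0 ≤ z.re → z.re ≤ 1 → ‖M z i j‖ ≤ C

theorem StripBounded.const (M : Matrix ι κ ℂ) : StripBounded fun _ => M :=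
  fun i j => ⟨differentiable_const _, ‖M i j‖, fun _ _ _ => le_rfl⟩

theorem StripBounded.mul [Fintype κ] {M : ℂ → Matrix ι κ ℂ} {N : ℂ → Matrix κ μ ℂ}
    (hM : StripBounded M) (hN : StripBounded N) : StripBounded fun z => M z * N z := by
  intro i j
  choose hMd CM hCM using hM
  choose hNd CN hCN using hN
  simp only [mul_apply]
  refine ⟨Differentiable.fun_sum fun k _ => (hMd i k).mul (hNd k j), ∑ k, CM i k * CN k j,
    fun z h0 h1 => (norm_sum_le _ _).trans (Finset.sum_le_sum fun k _ => ?_)⟩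
  rw [norm_mul]
  exact mul_le_mul (hCM i k z h0 h1) (hCN k j z h0 h1) (norm_nonneg _)
    ((norm_nonneg _).trans (hCM i k z h0 h1))

theorem StripBounded.kronecker_one [DecidableEq κ] {M : ℂ → Matrix ι ι ℂ}
    (hM : StripBounded M) : StripBounded fun z => M z ⊗ₖ (1 : Matrix κ κ ℂ) := by
  intro i j
  obtain ⟨hd, C, hC⟩ := hM i.1 j.1
  simp only [kroneckerMap_apply]
  refine ⟨hd.mul (differentiable_const _), C * ‖(1 : Matrix κ κ ℂ) i.2 j.2‖, fun z h0 h1 => ?_⟩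
  exact (norm_mul _ _).trans_le (mul_le_mul_of_nonneg_right (hC z h0 h1) (norm_nonneg _))

theorem StripBounded.cpowSupp [Fintype ι] [DecidableEq ι] {A : Matrix ι ι ℂ}
    (hA : A.IsHermitian) (a b : ℝ) :
    StripBounded fun z => cpowSupp A ((a : ℂ) * z + (b : ℂ)) := by
  have hdiag : StripBounded fun z : ℂ =>
      diagonal fun i => suppPow ((a : ℂ) * z + (b : ℂ)) (hA.eigenvalues i) := by
    intro i j
    by_cases hij : i = j
    · subst hij
      simp only [diagonal_apply_eq]
      unfold suppPow
      split_ifs with h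
      · exact ⟨differentiable_const _, 0, by simp⟩
      · set l := Real.log (hA.eigenvalues i)
        refine ⟨by fun_prop, Real.exp ((|a| + |b|) * |l|), fun z h0 h1 => ?_⟩
        rw [Complex.norm_exp, Complex.re_mul_ofReal, Real.exp_le_exp]
        have h2 : ((a : ℂ) * z + (b : ℂ)).re = a * z.re + b := by simp
        rw [h2]
        refine (le_abs_self _).trans ?_
        rw [abs_mul]
        refine mul_le_mul_of_nonneg_right ((abs_add_le _ _).trans ?_) (abs_nonneg _)
        rw [abs_mul, abs_of_nonneg h0]
        gcongr
        exact mul_le_of_le_one_right (abs_nonneg _) h1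
    · simp only [diagonal_apply_ne _ hij]
      exact ⟨differentiable_const _, 0, by simp⟩
  have h := ((StripBounded.const (hA.eigenvectorUnitary : Matrix ι ι ℂ)).mul hdiag).mul
    (StripBounded.const (star (hA.eigenvectorUnitary : Matrix ι ι ℂ)))
  simpa only [_root_.cpowSupp, hermFun_of_isHermitian hA] using h

/-- Three-lines theorem for the trace of a matrix-valued function. -/
theorem StripBounded.norm_trace_le [Fintype ι] {M : ℂ → Matrix ι ι ℂ}
    (hM : StripBounded M) {a b : ℝ}
    (ha : ∀ z : ℂ, z.re = 0 → ‖(M z).trace‖ ≤ a) (hb : ∀ z : ℂ, z.re = 1 → ‖(M z).trace‖ ≤ b)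
    {t : ℝ} (h0 : 0 ≤ t) (h1 : t ≤ 1) :
    ‖(M t).trace‖ ≤ a ^ (1 - t) * b ^ t := by
  choose hd C hC using hM
  have h := Complex.HadamardThreeLines.norm_le_interp_of_mem_verticalClosedStrip'
    (f := fun z => (M z).trace) (z := (t : ℂ)) (a := a) (b := b) (l := 0) (u := 1) one_pos
    ⟨by simpa using h0, by simpa using h1⟩
    (Differentiable.fun_sum fun k _ => hd k k).diffContOnCl
    ⟨∑ k, C k k, by
      rintro _ ⟨z, hz, rfl⟩
      exact (norm_sum_le _ _).trans (Finset.sum_le_sum fun k _ => hC k k z hz.1 hz.2)⟩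
    (fun z hz => ha z hz) (fun z hz => hb z hz)
  simpa using h

end Strip

section PartialTrace

variable {ι κ : Type*}

theorem ptrace2_posSemidef [Fintype κ] {A : Matrix (ι × κ) (ι × κ) ℂ} (hA : A.PosSemidef) :
    (ptrace2 A).PosSemidef := by
  have h : ptrace2 A = ∑ k : κ, A.submatrix (fun i => (i, k)) (fun i => (i, k)) := by
    ext i j
    simp [ptrace2, Matrix.sum_apply]
  rw [h]
  exact posSemidef_sum _ fun k _ => hA.submatrix _

theorem trace_mul_kronecker_one [Fintype ι] [Fintype κ] [DecidableEq κ]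
    (A : Matrix (ι × κ) (ι × κ) ℂ) (Y : Matrix ι ι ℂ) :
    (A * (Y ⊗ₖ (1 : Matrix κ κ ℂ))).trace = (ptrace2 A * Y).trace := by
  simp only [trace, diag_apply, mul_apply, kronecker_apply, Fintype.sum_prod_type, ptrace2,
    of_apply, one_apply, mul_ite, mul_one, mul_zero, Finset.sum_ite_eq', Finset.mem_univ, if_true,
    Finset.sum_mul]
  refine Finset.sum_congr rfl fun i _ => ?_
  rw [Finset.sum_comm]

variable [Fintype ι] [DecidableEq ι] [Fintype κ] [DecidableEq κ]

theorem hsSq_cpowSupp_half_mul {A : Matrix ι ι ℂ} (hA : A.PosSemidef) (Y : Matrix ι ι ℂ) :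
    hsSq (cpowSupp A (1 / 2) * Y) = (A * (Y * Yᴴ)).trace.re := by
  have h : star (1 / 2 : ℂ) + 1 / 2 = 1 := by
    apply Complex.ext <;> norm_num
  have e : (cpowSupp A (1 / 2) * Y)ᴴ * (cpowSupp A (1 / 2) * Y) = Yᴴ * (A * Y) := by
    rw [conjTranspose_mul, cpowSupp_conjTranspose]
    conv_rhs => rw [← cpowSupp_one hA, ← h, ← cpowSupp_mul]
    simp only [mul_assoc]
  rw [hsSq, e, trace_mul_comm, mul_assoc]

theorem hsSq_cpowSupp_half_mul_kronecker_one {A : Matrix (ι × κ) (ι × κ) ℂ} (hA : A.PosSemidef)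
    (Y : Matrix ι ι ℂ) :
    hsSq (cpowSupp A (1 / 2) * (Y ⊗ₖ (1 : Matrix κ κ ℂ))) =
      hsSq (cpowSupp (ptrace2 A) (1 / 2) * Y) := by
  rw [hsSq_cpowSupp_half_mul hA, hsSq_cpowSupp_half_mul (ptrace2_posSemidef hA),
    conjTranspose_kronecker, ← mul_kronecker_mul, conjTranspose_one, mul_one,
    trace_mul_kronecker_one]

theorem hsSq_kronecker_one_mul_cpowSupp_half {A : Matrix (ι × κ) (ι × κ) ℂ} (hA : A.PosSemidef)
    (Y : Matrix ι ι ℂ) :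
    hsSq ((Y ⊗ₖ (1 : Matrix κ κ ℂ)) * cpowSupp A (1 / 2)) =
      hsSq (Y * cpowSupp (ptrace2 A) (1 / 2)) := by
  have h : star (1 / 2 : ℂ) = 1 / 2 := by apply Complex.ext <;> norm_num
  rw [← hsSq_conjTranspose, ← hsSq_conjTranspose (Y * _), conjTranspose_mul, conjTranspose_mul,
    cpowSupp_conjTranspose, cpowSupp_conjTranspose, h, conjTranspose_kronecker,
    conjTranspose_one, hsSq_cpowSupp_half_mul_kronecker_one hA]

/-- The support of `A` is contained in that of its partial trace. -/
theorem cpowSupp_mul_supp_ptrace2 {A : Matrix (ι × κ) (ι × κ) ℂ} (hA : A.PosSemidef) (z : ℂ) :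
    cpowSupp A z * (cpowSupp (ptrace2 A) 0 ⊗ₖ (1 : Matrix κ κ ℂ)) = cpowSupp A z := by
  have h : cpowSupp A (1 / 2) * ((1 - cpowSupp (ptrace2 A) 0) ⊗ₖ (1 : Matrix κ κ ℂ)) = 0 := by
    apply eq_zero_of_hsSq_eq_zero
    rw [hsSq_cpowSupp_half_mul_kronecker_one hA, mul_sub, cpowSupp_mul]
    simp [hsSq]
  have h' : (1 - cpowSupp (ptrace2 A) 0) ⊗ₖ (1 : Matrix κ κ ℂ) =
      1 - cpowSupp (ptrace2 A) 0 ⊗ₖ (1 : Matrix κ κ ℂ) := by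
    rw [eq_sub_iff_add_eq, ← add_kronecker, sub_add_cancel, one_kronecker_one]
  rw [h', mul_sub, mul_one, sub_eq_zero] at h
  have hz : z = (z - 1 / 2) + 1 / 2 := by ring
  rw [hz, ← cpowSupp_mul, mul_assoc, ← h]

theorem supp_ptrace2_mul_cpowSupp {A : Matrix (ι × κ) (ι × κ) ℂ} (hA : A.PosSemidef) (z : ℂ) :
    (cpowSupp (ptrace2 A) 0 ⊗ₖ (1 : Matrix κ κ ℂ)) * cpowSupp A z = cpowSupp A z := by
  have h := congrArg conjTranspose (cpowSupp_mul_supp_ptrace2 hA (star z))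
  simpa [conjTranspose_kronecker, cpowSupp_conjTranspose] using h

end PartialTrace

section Polar

variable {ι : Type*} [Fintype ι] [DecidableEq ι]

/-- The partial isometry in the polar decomposition of `N`. -/
noncomputable def polarIsometry (N : Matrix ι ι ℂ) : Matrix ι ι ℂ :=
  N * cpowSupp (Nᴴ * N) (-1 / 2)

theorem polarIsometry_conjTranspose_mul_self (N : Matrix ι ι ℂ) :
    (polarIsometry N)ᴴ * polarIsometry N = cpowSupp (Nᴴ * N) 0 := by
  have hD : (Nᴴ * N).PosSemidef := posSemidef_conjTranspose_mul_self N
  have h : star (-1 / 2 : ℂ) + (1 + -1 / 2) = 0 := by apply Complex.ext <;> norm_num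
  rw [polarIsometry, conjTranspose_mul, cpowSupp_conjTranspose, mul_assoc, ← mul_assoc Nᴴ]
  nth_rw 2 [← cpowSupp_one hD]
  rw [cpowSupp_mul, cpowSupp_mul, h]

theorem polarIsometry_mul_cpowSupp_half (N : Matrix ι ι ℂ) :
    polarIsometry N * cpowSupp (Nᴴ * N) (1 / 2) = N := by
  have h : (-1 / 2 : ℂ) + 1 / 2 = 0 := by norm_num
  rw [polarIsometry, mul_assoc, cpowSupp_mul, h, mul_cpowSupp_zero]

theorem hsSq_polarIsometry_mul_cpowSupp (N : Matrix ι ι ℂ) (z : ℂ) :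
    hsSq (polarIsometry N * cpowSupp (Nᴴ * N) z) = hsSq (cpowSupp (Nᴴ * N) z) := by
  rw [hsSq, hsSq, conjTranspose_mul, mul_assoc, ← mul_assoc _ (polarIsometry N),
    polarIsometry_conjTranspose_mul_self, cpowSupp_mul, zero_add]

theorem hsSq_cpowSupp_mul_polarIsometry (N : Matrix ι ι ℂ) (z : ℂ) :
    hsSq (cpowSupp (Nᴴ * N) z * (polarIsometry N)ᴴ) = hsSq (cpowSupp (Nᴴ * N) z) := by
  rw [← hsSq_conjTranspose, conjTranspose_mul, conjTranspose_conjTranspose,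
    cpowSupp_conjTranspose, hsSq_polarIsometry_mul_cpowSupp, ← cpowSupp_conjTranspose,
    hsSq_conjTranspose]

theorem aFid_eq_polar {A B : Matrix ι ι ℂ} (hA : A.PosSemidef) (hB : B.PosSemidef) {α : ℝ}
    (hα : (1 - α) / (2 * α) ≠ 0) {N : Matrix ι ι ℂ}
    (hN : N = cpowSupp A (1 / 2) * cpowSupp B (((1 - α) / (2 * α) : ℝ) : ℂ)) :
    aFid α A B = (mpow (Nᴴ * N) α).trace.re := by
  have h : star (1 / 2 : ℂ) + 1 / 2 = 1 := by
    apply Complex.ext <;> norm_num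
  have e : Nᴴ * N = mpow B ((1 - α) / (2 * α)) * A * mpow B ((1 - α) / (2 * α)) := by
    conv_rhs => enter [1, 2]; rw [← cpowSupp_one hA, ← h, ← cpowSupp_mul]
    rw [hN, cpowSupp_ofReal hB hα, conjTranspose_mul, (mpow_posSemidef hB _).1.eq,
      cpowSupp_conjTranspose]
    simp only [mul_assoc]
  rw [aFid, e]

end Polar

section DataProcessing

variable {ι κ : Type*} [Fintype ι] [DecidableEq ι] [Fintype κ] [DecidableEq κ]

/-- Endpoint estimate at real part zero for the interpolation in `aFid_le_aFid_ptrace2`. -/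
theorem norm_trace_left_endpoint_le {ρ σ : Matrix (ι × κ) (ι × κ) ℂ} (hρ : ρ.PosSemidef)
    (hσ : σ.PosSemidef) (X : Matrix ι ι ℂ) (C : Matrix (ι × κ) (ι × κ) ℂ) {u v : ℂ}
    (hu : u.re = 0) (hv : v.re = 0) :
    ‖(cpowSupp ρ (1 / 2) * ((cpowSupp (ptrace2 ρ) (-1 / 2) * (X * cpowSupp (ptrace2 σ) u)) ⊗ₖ
      (1 : Matrix κ κ ℂ)) * (cpowSupp σ v * C)).trace‖ ≤ √(hsSq X) * √(hsSq C) := by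
  have h : (1 / 2 : ℂ) + -1 / 2 = 0 := by norm_num
  refine (norm_trace_mul_le _ _).trans ?_
  gcongr
  · rw [hsSq_cpowSupp_half_mul_kronecker_one hρ, ← mul_assoc, cpowSupp_mul, h]
    exact (hsSq_cpowSupp_mul_le (ptrace2_posSemidef hρ).1 rfl _).trans
      (hsSq_mul_cpowSupp_le (ptrace2_posSemidef hσ).1 hu _)
  · exact hsSq_cpowSupp_mul_le hσ.1 hv _

/-- Endpoint estimate at real part one for the interpolation in `aFid_le_aFid_ptrace2`. -/
theorem norm_trace_right_endpoint_le {ρ σ : Matrix (ι × κ) (ι × κ) ℂ} (hρ : ρ.PosSemidef)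
    (hσ : σ.PosSemidef) (X Y : Matrix ι ι ℂ) {C : Matrix (ι × κ) (ι × κ) ℂ}
    (hC : (1 - C * Cᴴ).PosSemidef) {u v : ℂ} (hu : u.re = -1 / 2) (hv : v.re = 1 / 2) :
    ‖(cpowSupp ρ (1 / 2) * ((cpowSupp (ptrace2 ρ) (-1 / 2) * (X * Y * cpowSupp (ptrace2 σ) u)) ⊗ₖ
      (1 : Matrix κ κ ℂ)) * (cpowSupp σ v * C)).trace‖ ≤ √(hsSq X) * √(hsSq Y) := by
  have h : (1 / 2 : ℂ) + -1 / 2 = 0 := by norm_num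
  have e : cpowSupp ρ (1 / 2) * ((cpowSupp (ptrace2 ρ) (-1 / 2) *
      (X * Y * cpowSupp (ptrace2 σ) u)) ⊗ₖ (1 : Matrix κ κ ℂ)) * (cpowSupp σ v * C) =
      (cpowSupp ρ (1 / 2) * ((cpowSupp (ptrace2 ρ) (-1 / 2) * X) ⊗ₖ (1 : Matrix κ κ ℂ))) *
      (((Y * cpowSupp (ptrace2 σ) u) ⊗ₖ (1 : Matrix κ κ ℂ)) * cpowSupp σ (1 / 2) *
        cpowSupp σ (v - 1 / 2) * C) := by
    have e1 : (cpowSupp (ptrace2 ρ) (-1 / 2) * (X * Y * cpowSupp (ptrace2 σ) u)) ⊗ₖ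
        (1 : Matrix κ κ ℂ) = ((cpowSupp (ptrace2 ρ) (-1 / 2) * X) ⊗ₖ (1 : Matrix κ κ ℂ)) *
          ((Y * cpowSupp (ptrace2 σ) u) ⊗ₖ (1 : Matrix κ κ ℂ)) := by
      rw [← mul_kronecker_mul, one_mul]
      simp only [mul_assoc]
    have e2 : cpowSupp σ v = cpowSupp σ (1 / 2) * cpowSupp σ (v - 1 / 2) := by
      rw [cpowSupp_mul, add_sub_cancel]
    rw [e1, e2]
    simp only [mul_assoc]
  rw [e]
  refine (norm_trace_mul_le _ _).trans ?_
  gcongr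
  · rw [hsSq_cpowSupp_half_mul_kronecker_one hρ, ← mul_assoc, cpowSupp_mul, h]
    exact hsSq_cpowSupp_mul_le (ptrace2_posSemidef hρ).1 rfl _
  · refine (hsSq_mul_le_right hC _).trans ((hsSq_mul_cpowSupp_le hσ.1 ?_ _).trans ?_)
    · rw [Complex.sub_re, hv]; norm_num
    · rw [hsSq_kronecker_one_mul_cpowSupp_half hσ, mul_assoc, cpowSupp_mul]
      refine hsSq_mul_cpowSupp_le (ptrace2_posSemidef hσ).1 ?_ _
      rw [Complex.add_re, hu]; norm_num

/-- Data processing for the `α`-fidelity under the partial trace. -/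
theorem aFid_le_aFid_ptrace2 {α : ℝ} (hα : 1 / 2 ≤ α) (hα' : α < 1)
    {ρ σ : Matrix (ι × κ) (ι × κ) ℂ} (hρ : ρ.PosSemidef) (hσ : σ.PosSemidef) :
    aFid α ρ σ ≤ aFid α (ptrace2 ρ) (ptrace2 σ) := by
  have hα0 : 0 < α := by linarith
  have hρA := ptrace2_posSemidef hρ
  have hσA := ptrace2_posSemidef hσ
  set s : ℝ := (1 - α) / (2 * α) with hs
  have hs0 : s ≠ 0 := (div_pos (by linarith) (by linarith)).ne'
  obtain ⟨M, hM⟩ : ∃ M, M = cpowSupp ρ (1 / 2) * cpowSupp σ (s : ℂ) := ⟨_, rfl⟩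
  obtain ⟨N, hN⟩ : ∃ N, N = cpowSupp (ptrace2 ρ) (1 / 2) * cpowSupp (ptrace2 σ) (s : ℂ) :=
    ⟨_, rfl⟩
  rw [aFid_eq_polar hρ hσ hs0 hM, aFid_eq_polar hρA hσA hs0 hN]
  have hG : (Mᴴ * M).PosSemidef := posSemidef_conjTranspose_mul_self M
  have hD : (Nᴴ * N).PosSemidef := posSemidef_conjTranspose_mul_self N
  set Φ := (mpow (Mᴴ * M) α).trace.re with hΦ
  set Ψ := (mpow (Nᴴ * N) α).trace.re with hΨ
  have hΦ0 : 0 ≤ Φ := (Complex.le_def.1 (mpow_posSemidef hG α).trace_nonneg).1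
  have hΨ0 : 0 ≤ Ψ := (Complex.le_def.1 (mpow_posSemidef hD α).trace_nonneg).1
  set c : ℝ := α / 2 with hc
  set θ : ℝ := 1 / α - 1 with hθ
  have hθ0 : 0 < θ := by rw [hθ, sub_pos]; exact one_lt_one_div hα0 hα'
  have hθ1 : θ ≤ 1 := by
    rw [hθ, sub_le_iff_le_add, div_le_iff₀ hα0]; linarith
  have hsθ : s = θ / 2 := by rw [hs, hθ]; field_simp
  have hcθ : c * θ = 1 / 2 - c := by rw [hc, hθ]; field_simp
  let F : ℂ → Matrix (ι × κ) (ι × κ) ℂ := fun z =>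
    cpowSupp ρ (1 / 2) * ((cpowSupp (ptrace2 ρ) (-1 / 2) *
      (polarIsometry N * cpowSupp (Nᴴ * N) ((c : ℂ) * z + (c : ℂ)) *
        cpowSupp (ptrace2 σ) (((-1 / 2 : ℝ) : ℂ) * z + ((0 : ℝ) : ℂ)))) ⊗ₖ (1 : Matrix κ κ ℂ)) *
    (cpowSupp σ (((1 / 2 : ℝ) : ℂ) * z + ((0 : ℝ) : ℂ)) *
      (cpowSupp (Mᴴ * M) (((-c : ℝ) : ℂ) * z + (c : ℂ)) * (polarIsometry M)ᴴ))
  have hF : StripBounded F :=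
    ((StripBounded.const _).mul ((StripBounded.const _).mul
      (((StripBounded.const _).mul (.cpowSupp hD.1 c c)).mul
        (.cpowSupp hσA.1 _ _))).kronecker_one).mul
      ((StripBounded.cpowSupp hσ.1 _ _).mul
        ((StripBounded.cpowSupp hG.1 (-c) c).mul (StripBounded.const _)))
  have hleft : ∀ z : ℂ, z.re = 0 → ‖(F z).trace‖ ≤ √Ψ * √Φ := by
    intro z hz
    refine (norm_trace_left_endpoint_le hρ hσ _ _ (by simp [hz]) (by simp [hz])).trans_eq ?_
    rw [hsSq_polarIsometry_mul_cpowSupp, hsSq_cpowSupp_mul_polarIsometry,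
      hsSq_cpowSupp hD hα0.ne', hsSq_cpowSupp hG hα0.ne']
    · simp [hz, hc]; ring
    · simp [hz, hc]; ring
  have hright : ∀ z : ℂ, z.re = 1 → ‖(F z).trace‖ ≤ Ψ := by
    intro z hz
    have hX : polarIsometry N * cpowSupp (Nᴴ * N) ((c : ℂ) * z + (c : ℂ)) =
        polarIsometry N * cpowSupp (Nᴴ * N) (c : ℂ) * cpowSupp (Nᴴ * N) ((c : ℂ) * z) := by
      rw [mul_assoc, cpowSupp_mul, add_comm]
    have hC : (1 - (cpowSupp (Mᴴ * M) (((-c : ℝ) : ℂ) * z + (c : ℂ)) * (polarIsometry M)ᴴ) *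
        (cpowSupp (Mᴴ * M) (((-c : ℝ) : ℂ) * z + (c : ℂ)) * (polarIsometry M)ᴴ)ᴴ).PosSemidef := by
      have e := polarIsometry_conjTranspose_mul_self M
      set w := ((-c : ℝ) : ℂ) * z + (c : ℂ) with hw
      have hw0 : w + (0 + star w) = 0 := by
        have : w.re = 0 := by simp [hw, hz]
        apply Complex.ext <;> simp [this]
      rw [conjTranspose_mul, conjTranspose_conjTranspose, mul_assoc,
        ← mul_assoc _ (polarIsometry M), e, cpowSupp_conjTranspose, cpowSupp_mul, cpowSupp_mul, hw0]
      exact one_sub_cpowSupp_zero_posSemidef hG.1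
    have h := norm_trace_right_endpoint_le hρ hσ
      (polarIsometry N * cpowSupp (Nᴴ * N) (c : ℂ)) (cpowSupp (Nᴴ * N) ((c : ℂ) * z)) hC
      (u := ((-1 / 2 : ℝ) : ℂ) * z + ((0 : ℝ) : ℂ)) (v := ((1 / 2 : ℝ) : ℂ) * z + ((0 : ℝ) : ℂ))
      (by rw [Complex.add_re, Complex.re_ofReal_mul, hz]; norm_num)
      (by rw [Complex.add_re, Complex.re_ofReal_mul, hz]; norm_num)
    rw [← hX, hsSq_polarIsometry_mul_cpowSupp, hsSq_cpowSupp hD hα0.ne' (by simp [hc]; ring),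
      hsSq_cpowSupp hD hα0.ne' (by simp [hc, hz]; ring), Real.mul_self_sqrt hΨ0] at h
    exact h
  have hval : (F θ).trace = (Φ : ℂ) := by
    have e1 : (c : ℂ) * (θ : ℂ) + (c : ℂ) = 1 / 2 := by
      rw [← Complex.ofReal_mul, hcθ]; push_cast; ring
    have e2 : ((-1 / 2 : ℝ) : ℂ) * (θ : ℂ) + ((0 : ℝ) : ℂ) = -(s : ℂ) := by
      rw [hsθ]; push_cast; ring
    have e3 : ((1 / 2 : ℝ) : ℂ) * (θ : ℂ) + ((0 : ℝ) : ℂ) = (s : ℂ) := by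
      rw [hsθ]; push_cast; ring
    have e4 : (1 : ℂ) + (((-c : ℝ) : ℂ) * (θ : ℂ) + (c : ℂ) + star (-1 / 2)) = (α : ℂ) := by
      have : star (-1 / 2 : ℂ) = ((-1 / 2 : ℝ) : ℂ) := by apply Complex.ext <;> norm_num
      rw [this, ← Complex.ofReal_mul, neg_mul, hcθ, hc]
      push_cast; ring
    have e5 : cpowSupp (ptrace2 ρ) (-1 / 2) * (N * cpowSupp (ptrace2 σ) (-(s : ℂ))) =
        cpowSupp (ptrace2 ρ) 0 * cpowSupp (ptrace2 σ) 0 := by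
      rw [hN, mul_assoc, cpowSupp_mul, ← mul_assoc, cpowSupp_mul, add_neg_cancel]
      norm_num
    have e6 : cpowSupp ρ (1 / 2) * ((cpowSupp (ptrace2 ρ) 0 * cpowSupp (ptrace2 σ) 0) ⊗ₖ
        (1 : Matrix κ κ ℂ)) * cpowSupp σ (s : ℂ) = M := by
      have : (cpowSupp (ptrace2 ρ) 0 * cpowSupp (ptrace2 σ) 0) ⊗ₖ (1 : Matrix κ κ ℂ) =
          (cpowSupp (ptrace2 ρ) 0 ⊗ₖ (1 : Matrix κ κ ℂ)) *
            (cpowSupp (ptrace2 σ) 0 ⊗ₖ (1 : Matrix κ κ ℂ)) := by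
        rw [← mul_kronecker_mul, one_mul]
      rw [this, ← mul_assoc, cpowSupp_mul_supp_ptrace2 hρ, mul_assoc,
        supp_ptrace2_mul_cpowSupp hσ, hM]
    simp only [F]
    rw [e1, e2, e3, polarIsometry_mul_cpowSupp_half, e5, ← mul_assoc, e6, polarIsometry,
      conjTranspose_mul, cpowSupp_conjTranspose, ← mul_assoc (cpowSupp (Mᴴ * M) _), cpowSupp_mul,
      ← mul_assoc, trace_mul_comm, ← mul_assoc]
    nth_rw 1 [← cpowSupp_one hG]
    rw [cpowSupp_mul, e4, cpowSupp_ofReal hG hα0.ne', hΦ, trace_mpow hG.1, Complex.ofReal_re]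
  have hmain := hF.norm_trace_le hleft hright hθ0.le hθ1
  rw [hval, Complex.norm_of_nonneg hΦ0] at hmain
  rcases hΦ0.eq_or_lt with h0 | hpos
  · rwa [← h0]
  by_contra! hlt
  have hlast : (√Ψ * √Φ) ^ (1 - θ) * Ψ ^ θ < Φ := by
    calc (√Ψ * √Φ) ^ (1 - θ) * Ψ ^ θ ≤ Φ ^ (1 - θ) * Ψ ^ θ := by
          refine mul_le_mul_of_nonneg_right ?_ (Real.rpow_nonneg hΨ0 _)
          refine Real.rpow_le_rpow (by positivity) ?_ (by linarith)
          calc √Ψ * √Φ ≤ √Φ * √Φ := by gcongr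
            _ = Φ := Real.mul_self_sqrt hΦ0
      _ < Φ ^ (1 - θ) * Φ ^ θ :=
          mul_lt_mul_of_pos_left (Real.rpow_lt_rpow hΨ0 hlt hθ0) (Real.rpow_pos_of_pos hpos _)
      _ = Φ := by rw [← Real.rpow_add hpos, sub_add_cancel, Real.rpow_one]
  exact hlast.not_ge hmain

end DataProcessing

/-- the α-fidelity of the outputs of two channels induced by environmental
states `ξ₁, ξ₂` through a common unitary coupling is bounded below by the product of the
α-fidelities of the inputs and of the environmental states. -/
theorem stmt0 {n m : ℕ} (α : ℝ) (hα : (1 : ℝ) / 2 ≤ α) (hα' : α < 1)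
    (ρ₁ ρ₂ : Matrix (Fin n) (Fin n) ℂ) (hρ₁ : IsDensity ρ₁) (hρ₂ : IsDensity ρ₂)
    (ξ₁ ξ₂ : Matrix (Fin m) (Fin m) ℂ) (hξ₁ : IsDensity ξ₁) (hξ₂ : IsDensity ξ₂)
    (U : Matrix (Fin n × Fin m) (Fin n × Fin m) ℂ)
    (hU : U ∈ Matrix.unitaryGroup (Fin n × Fin m) ℂ)
    (E₁ E₂ : Matrix (Fin n) (Fin n) ℂ → Matrix (Fin n) (Fin n) ℂ)
    (hE₁ : ∀ ρ, E₁ ρ = ptrace2 (U * (ρ ⊗ₖ ξ₁) * Uᴴ))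
    (hE₂ : ∀ ρ, E₂ ρ = ptrace2 (U * (ρ ⊗ₖ ξ₂) * Uᴴ)) :
    aFid α ρ₁ ρ₂ * aFid α ξ₁ ξ₂ ≤ aFid α (E₁ ρ₁) (E₂ ρ₂) := by
  have hUU : ∀ {A : Matrix (Fin n × Fin m) (Fin n × Fin m) ℂ}, A.PosSemidef →
      (U * A * Uᴴ).PosSemidef := fun hA => hA.mul_mul_conjTranspose_same U
  have h₁ := hρ₁.1.kronecker hξ₁.1
  have h₂ := hρ₂.1.kronecker hξ₂.1
  rw [hE₁, hE₂, ← aFid_kronecker hρ₁.1 hρ₂.1 hξ₁.1 hξ₂.1, ← aFid_conj hU h₁ h₂]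
  exact aFid_le_aFid_ptrace2 hα hα' (hUU h₁) (hUU h₂)
end

section
/- Let α ∈ [1/2, 1). Let ρ₁, ρ₂ be density matrices on ℂ^n with tr(ρ₁ρ₂) ≠ 0, let ξ₁, ξ₂ be density matrices on ℂ^m with tr(ξ₁ξ₂) ≠ 0, let U be a unitary complex matrix with rows and columns indexed by Fin n × Fin m, and define E_i(ρ) = Tr₂(U (ρ ⊗ ξ_i) U*) for i = 1, 2. Then tr(E₁(ρ₁) · E₂(ρ₂)) ≠ 0 and S_α(E₁(ρ₁) ‖ E₂(ρ₂)) − S_α(ρ₁ ‖ ρ₂) ≤ S_α(ξ₁ ‖ ξ₂). -/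
open Matrix
open scoped Kronecker ComplexOrder

/-- The sandwiched α-Rényi divergence `S_α(ρ‖σ) = (1/(α−1)) log F_α(ρ,σ)`. -/
noncomputable def renyiDiv {ι : Type*} [Fintype ι] [DecidableEq ι]
    (α : ℝ) (ρ σ : Matrix ι ι ℂ) : ℝ :=
  (1 / (α - 1)) * Real.log (aFid α ρ σ)

/-- `V` is a unitary matrix diagonalizing `A` with real eigenvalues `d`. -/
structure Diagonalizes {ι : Type*} [Fintype ι] [DecidableEq ι]
    (V : Matrix ι ι ℂ) (d : ι → ℝ) (A : Matrix ι ι ℂ) : Prop where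
  star_mul : Vᴴ * V = 1
  mul_star : V * Vᴴ = 1
  eq : A = V * diagonal (fun i => (d i : ℂ)) * Vᴴ

section Diagonalization

variable {ι : Type*} [Fintype ι] [DecidableEq ι] {A B V W : Matrix ι ι ℂ} {d e : ι → ℝ}

theorem Matrix.IsHermitian.diagonalizes (hA : A.IsHermitian) :
    Diagonalizes (hA.eigenvectorUnitary : Matrix ι ι ℂ) hA.eigenvalues A where
  star_mul := Unitary.coe_star_mul_self hA.eigenvectorUnitary
  mul_star := Unitary.coe_mul_star_self hA.eigenvectorUnitary
  eq := by
    conv_lhs => rw [hA.spectral_theorem, Unitary.conjStarAlgAut_apply]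
    rfl

theorem Matrix.PosSemidef.exists_diagonalizes (hA : A.PosSemidef) :
    ∃ V d, Diagonalizes V d A ∧ ∀ i, 0 ≤ d i :=
  ⟨_, _, hA.isHermitian.diagonalizes, hA.eigenvalues_nonneg⟩

theorem Matrix.PosDef.exists_diagonalizes (hA : A.PosDef) :
    ∃ V d, Diagonalizes V d A ∧ ∀ i, 0 < d i :=
  ⟨_, _, hA.isHermitian.diagonalizes, hA.eigenvalues_pos⟩

namespace Diagonalizes

theorem isHermitian (h : Diagonalizes V d A) : A.IsHermitian := by
  rw [h.eq, IsHermitian, conjTranspose_mul, conjTranspose_mul, diagonal_conjTranspose,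
    conjTranspose_conjTranspose, Matrix.mul_assoc]
  congr 3
  ext i
  simp

/-- A function of a matrix does not depend on the chosen diagonalization. -/
theorem map_unique (h : Diagonalizes V d A) (h' : Diagonalizes W e A) (f : ℝ → ℝ) :
    V * diagonal (fun i => (f (d i) : ℂ)) * Vᴴ = W * diagonal (fun i => (f (e i) : ℂ)) * Wᴴ := by
  have key : ∀ g : ℝ → ℝ, V * diagonal (fun i => (g (d i) : ℂ)) * Vᴴ =
      W * diagonal (fun i => (g (e i) : ℂ)) * Wᴴ ↔
      (Wᴴ * V) * diagonal (fun i => (g (d i) : ℂ)) =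
        diagonal (fun i => (g (e i) : ℂ)) * (Wᴴ * V) := by
    intro g
    constructor
    · intro hg
      calc (Wᴴ * V) * diagonal (fun i => (g (d i) : ℂ))
          = Wᴴ * (V * diagonal (fun i => (g (d i) : ℂ)) * Vᴴ) * V := by
            simp only [Matrix.mul_assoc, h.star_mul, Matrix.mul_one]
        _ = (Wᴴ * W) * diagonal (fun i => (g (e i) : ℂ)) * (Wᴴ * V) := by
            rw [hg]; simp only [Matrix.mul_assoc]
        _ = _ := by rw [h'.star_mul, Matrix.one_mul]
    · intro hg
      calc V * diagonal (fun i => (g (d i) : ℂ)) * Vᴴ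
          = (W * Wᴴ) * V * diagonal (fun i => (g (d i) : ℂ)) * Vᴴ := by
            rw [h'.mul_star, Matrix.one_mul]
        _ = W * ((Wᴴ * V) * diagonal (fun i => (g (d i) : ℂ))) * Vᴴ := by
            simp only [Matrix.mul_assoc]
        _ = W * diagonal (fun i => (g (e i) : ℂ)) * Wᴴ * (V * Vᴴ) := by
            rw [hg]; simp only [Matrix.mul_assoc]
        _ = _ := by rw [h.mul_star, Matrix.mul_one]
  have h1 := (key id).1 (h.eq.symm.trans h'.eq)
  refine (key f).2 ?_
  ext i j
  have h2 := congrFun (congrFun h1 i) j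
  simp only [mul_diagonal, diagonal_mul, id] at h2 ⊢
  by_cases hde : d j = e i
  · rw [hde, mul_comm]
  · have h3 : (Wᴴ * V) i j * ((d j : ℂ) - (e i : ℂ)) = 0 := by linear_combination h2
    have h4 : ((d j : ℂ) - (e i : ℂ)) ≠ 0 := by
      rw [sub_ne_zero]; exact_mod_cast hde
    rw [(mul_eq_zero.1 h3).resolve_right h4]
    simp

theorem mpow_eq (h : Diagonalizes V d A) (t : ℝ) :
    mpow A t = V * diagonal (fun i => ((d i ^ t : ℝ) : ℂ)) * Vᴴ := by
  rw [mpow, dif_pos h.isHermitian]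
  exact h.isHermitian.diagonalizes.map_unique h (· ^ t)

theorem mpow (h : Diagonalizes V d A) (t : ℝ) :
    Diagonalizes V (fun i => d i ^ t) (mpow A t) :=
  ⟨h.star_mul, h.mul_star, h.mpow_eq t⟩

theorem mul (h : Diagonalizes V d A) (h' : Diagonalizes V e B) :
    Diagonalizes V (fun i => d i * e i) (A * B) := by
  refine ⟨h.star_mul, h.mul_star, ?_⟩
  calc A * B = V * diagonal (fun i => (d i : ℂ)) * (Vᴴ * V) *
        diagonal (fun i => (e i : ℂ)) * Vᴴ := by
        rw [h.eq, h'.eq]; simp only [Matrix.mul_assoc]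
    _ = _ := by
        rw [h.star_mul, Matrix.mul_one, Matrix.mul_assoc V, diagonal_mul_diagonal]
        simp

theorem one (h : Diagonalizes V d A) : Diagonalizes V (fun _ => 1) (1 : Matrix ι ι ℂ) :=
  ⟨h.star_mul, h.mul_star, by simp [h.mul_star]⟩

theorem add (h : Diagonalizes V d A) (h' : Diagonalizes V e B) :
    Diagonalizes V (fun i => d i + e i) (A + B) := by
  refine ⟨h.star_mul, h.mul_star, ?_⟩
  rw [h.eq, h'.eq, ← Matrix.add_mul, ← Matrix.mul_add, diagonal_add]
  simp

theorem smul (h : Diagonalizes V d A) (c : ℝ) :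
    Diagonalizes V (fun i => c * d i) ((c : ℂ) • A) := by
  refine ⟨h.star_mul, h.mul_star, ?_⟩
  rw [h.eq, ← Matrix.smul_mul, ← Matrix.mul_smul, ← diagonal_smul]
  simp [Pi.smul_def]

theorem congr (h : Diagonalizes V d A) (hde : ∀ i, d i = e i) : Diagonalizes V e A := by
  rwa [← funext hde]

theorem ext (h : Diagonalizes V d A) (h' : Diagonalizes V e B) (hde : ∀ i, d i = e i) : A = B := by
  rw [h.eq, h'.eq, funext hde]

theorem trace_eq (h : Diagonalizes V d A) : A.trace = ((∑ i, d i : ℝ) : ℂ) := by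
  rw [h.eq, Matrix.mul_assoc, trace_mul_comm, Matrix.mul_assoc, h.star_mul, Matrix.mul_one,
    trace_diagonal]
  simp

theorem posSemidef (h : Diagonalizes V d A) (hd : ∀ i, 0 ≤ d i) : A.PosSemidef := by
  rw [h.eq]
  refine PosSemidef.mul_mul_conjTranspose_same (PosSemidef.diagonal fun i => ?_) _
  simpa using hd i

theorem posDef (h : Diagonalizes V d A) (hd : ∀ i, 0 < d i) : A.PosDef := by
  rw [(h.posSemidef fun i => (hd i).le).posDef_iff_isUnit]
  have h1 : Diagonalizes V (fun _ => 1) (A * _root_.mpow A (-1)) :=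
    (h.mul (h.mpow (-1))).congr fun i => by
      rw [Real.rpow_neg_one, mul_inv_cancel₀ (hd i).ne']
  exact IsUnit.of_mul_eq_one _ (h1.ext h.one fun _ => rfl)

/-- The trace form `tr(K* A K B)` in eigenbases of `A` and `B`. -/
theorem trace_overlap (h : Diagonalizes V d A) (h' : Diagonalizes W e B) (K : Matrix ι ι ℂ) :
    (Kᴴ * A * K * B).trace =
      ((∑ i, ∑ j, Complex.normSq ((Vᴴ * K * W) i j) * (d i * e j) : ℝ) : ℂ) := by
  set k := Vᴴ * K * W with hk
  have hkH : kᴴ = Wᴴ * Kᴴ * V := by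
    simp [hk, conjTranspose_mul, Matrix.mul_assoc]
  have h1 : (Kᴴ * A * K * B).trace =
      (kᴴ * diagonal (fun i => (d i : ℂ)) * k * diagonal (fun i => (e i : ℂ))).trace := by
    rw [h.eq, h'.eq, hkH, hk]
    simp only [Matrix.mul_assoc]
    rw [trace_mul_comm Wᴴ]
    simp only [Matrix.mul_assoc]
  rw [h1]
  simp only [trace, diag_apply, mul_diagonal]
  rw [Finset.sum_congr rfl fun j _ => by rw [Matrix.mul_apply, Finset.sum_mul], Finset.sum_comm]
  push_cast
  refine Finset.sum_congr rfl fun i _ => Finset.sum_congr rfl fun j _ => ?_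
  rw [mul_diagonal, conjTranspose_apply, Complex.normSq_eq_conj_mul_self]
  simp only [RCLike.star_def]
  ring

theorem kronecker {κ : Type*} [Fintype κ] [DecidableEq κ] {C Z : Matrix κ κ ℂ} {f : κ → ℝ}
    (h : Diagonalizes V d A) (h' : Diagonalizes Z f C) :
    Diagonalizes (V ⊗ₖ Z) (fun i => d i.1 * f i.2) (A ⊗ₖ C) := by
  refine ⟨?_, ?_, ?_⟩
  · rw [conjTranspose_kronecker, ← mul_kronecker_mul, h.star_mul, h'.star_mul, one_kronecker_one]
  · rw [conjTranspose_kronecker, ← mul_kronecker_mul, h.mul_star, h'.mul_star, one_kronecker_one]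
  · rw [conjTranspose_kronecker, h.eq, h'.eq, mul_kronecker_mul, mul_kronecker_mul,
      diagonal_kronecker_diagonal]
    simp

theorem unitary_conj (h : Diagonalizes V d A) {U : Matrix ι ι ℂ} (hU : U ∈ unitaryGroup ι ℂ) :
    Diagonalizes (U * V) d (U * A * Uᴴ) := by
  have h1 : Uᴴ * U = 1 := mem_unitaryGroup_iff'.1 hU
  have h2 : U * Uᴴ = 1 := mem_unitaryGroup_iff.1 hU
  refine ⟨?_, ?_, ?_⟩
  · rw [conjTranspose_mul, Matrix.mul_assoc, ← Matrix.mul_assoc Uᴴ, h1, Matrix.one_mul, h.star_mul]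
  · rw [conjTranspose_mul, Matrix.mul_assoc, ← Matrix.mul_assoc V, h.mul_star, Matrix.one_mul, h2]
  · rw [h.eq, conjTranspose_mul]; simp only [Matrix.mul_assoc]

end Diagonalizes

theorem mpow_isHermitian (A : Matrix ι ι ℂ) (t : ℝ) : (mpow A t).IsHermitian := by
  by_cases hA : A.IsHermitian
  · exact (hA.diagonalizes.mpow t).isHermitian
  · rw [mpow, dif_neg hA]; exact isHermitian_zero

theorem Matrix.PosSemidef.mpow (hA : A.PosSemidef) (t : ℝ) : (mpow A t).PosSemidef := by
  obtain ⟨V, d, h, hd⟩ := hA.exists_diagonalizes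
  exact (h.mpow t).posSemidef fun i => Real.rpow_nonneg (hd i) t

theorem Matrix.PosDef.mpow (hA : A.PosDef) (t : ℝ) : (mpow A t).PosDef := by
  obtain ⟨V, d, h, hd⟩ := hA.exists_diagonalizes
  exact (h.mpow t).posDef fun i => Real.rpow_pos_of_pos (hd i) t

theorem mpow_one (hA : A.IsHermitian) : mpow A 1 = A :=
  (hA.diagonalizes.mpow 1).ext hA.diagonalizes fun _ => Real.rpow_one _

theorem mpow_zero (hA : A.IsHermitian) : mpow A 0 = 1 :=
  (hA.diagonalizes.mpow 0).ext hA.diagonalizes.one fun _ => Real.rpow_zero _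

theorem mpow_mul_mpow (hA : A.PosDef) (s t : ℝ) : mpow A s * mpow A t = mpow A (s + t) := by
  obtain ⟨V, d, h, hd⟩ := hA.exists_diagonalizes
  exact ((h.mpow s).mul (h.mpow t)).ext (h.mpow _) fun i => (Real.rpow_add (hd i) s t).symm

theorem mpow_mul_mpow_neg (hA : A.PosDef) (s : ℝ) : mpow A s * mpow A (-s) = 1 := by
  rw [mpow_mul_mpow hA, add_neg_cancel, mpow_zero hA.isHermitian]

theorem mpow_neg_mul_mpow (hA : A.PosDef) (s : ℝ) : mpow A (-s) * mpow A s = 1 := by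
  rw [mpow_mul_mpow hA, neg_add_cancel, mpow_zero hA.isHermitian]

theorem mpow_mul_mpow_of_nonneg (hA : A.PosSemidef) {s t : ℝ} (hs : 0 ≤ s) (ht : 0 ≤ t) :
    mpow A s * mpow A t = mpow A (s + t) := by
  obtain ⟨V, d, h, hd⟩ := hA.exists_diagonalizes
  exact ((h.mpow s).mul (h.mpow t)).ext (h.mpow _) fun i =>
    (Real.rpow_add_of_nonneg (hd i) hs ht).symm

theorem mpow_mpow (hA : A.PosSemidef) (s t : ℝ) : mpow (mpow A s) t = mpow A (s * t) := by
  obtain ⟨V, d, h, hd⟩ := hA.exists_diagonalizes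
  exact ((h.mpow s).mpow t).ext (h.mpow _) fun i => (Real.rpow_mul (hd i) s t).symm

theorem mpow_kronecker_s1 {κ : Type*} [Fintype κ] [DecidableEq κ] {C : Matrix κ κ ℂ}
    (hA : A.PosSemidef) (hC : C.PosSemidef) (t : ℝ) :
    mpow (A ⊗ₖ C) t = mpow A t ⊗ₖ mpow C t := by
  obtain ⟨V, d, h, hd⟩ := hA.exists_diagonalizes
  obtain ⟨W, e, h', he⟩ := hC.exists_diagonalizes
  exact ((h.kronecker h').mpow t).ext ((h.mpow t).kronecker (h'.mpow t)) fun i =>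
    Real.mul_rpow (hd i.1) (he i.2)

theorem mpow_unitary_conj (hA : A.IsHermitian) {U : Matrix ι ι ℂ} (hU : U ∈ unitaryGroup ι ℂ)
    (t : ℝ) : mpow (U * A * Uᴴ) t = U * mpow A t * Uᴴ :=
  ((hA.diagonalizes.unitary_conj hU).mpow t).ext ((hA.diagonalizes.mpow t).unitary_conj hU)
    fun _ => rfl

/-- The trace of `A ^ t` depends only on the characteristic polynomial of `A`. -/
theorem trace_mpow_congr_charpoly (hA : A.IsHermitian) (hB : B.IsHermitian)
    (h : A.charpoly = B.charpoly) (t : ℝ) : (mpow A t).trace = (mpow B t).trace := by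
  rw [(hA.diagonalizes.mpow t).trace_eq, (hB.diagonalizes.mpow t).trace_eq,
    (hA.eigenvalues_eq_eigenvalues_iff hB).2 h]

theorem trace_mpow_conjTranspose_mul_comm (X : Matrix ι ι ℂ) (t : ℝ) :
    (mpow (X * Xᴴ) t).trace = (mpow (Xᴴ * X) t).trace :=
  trace_mpow_congr_charpoly (isHermitian_mul_conjTranspose_self X)
    (isHermitian_conjTranspose_mul_self X) (charpoly_mul_comm X Xᴴ) t

end Diagonalization

section PartialTrace

variable {ι κ : Type*} [Fintype κ]

theorem trace_kronecker_one_mul [Fintype ι] [DecidableEq κ] (X : Matrix ι ι ℂ)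
    (M : Matrix (ι × κ) (ι × κ) ℂ) :
    ((X ⊗ₖ (1 : Matrix κ κ ℂ)) * M).trace = (X * ptrace2 M).trace := by
  simp only [trace, diag_apply, Matrix.mul_apply, Fintype.sum_prod_type, kroneckerMap_apply,
    ptrace2, of_apply, Matrix.one_apply, mul_ite, mul_one, mul_zero, ite_mul, zero_mul,
    Finset.sum_ite_eq, Finset.mem_univ, if_true, Finset.mul_sum]
  exact Finset.sum_congr rfl fun i _ => Finset.sum_comm

theorem trace_kronecker_one_cost_left [Fintype ι] [DecidableEq κ]
    (σ : Matrix (ι × κ) (ι × κ) ℂ) (X : Matrix ι ι ℂ) :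
    ((X ⊗ₖ (1 : Matrix κ κ ℂ))ᴴ * σ * (X ⊗ₖ (1 : Matrix κ κ ℂ))).trace =
      (Xᴴ * ptrace2 σ * X).trace := by
  rw [trace_mul_comm, trace_mul_comm (Xᴴ * ptrace2 σ), ← Matrix.mul_assoc, ← Matrix.mul_assoc,
    conjTranspose_kronecker, conjTranspose_one, ← mul_kronecker_mul, Matrix.mul_one,
    trace_kronecker_one_mul]

theorem trace_kronecker_one_cost_right [Fintype ι] [DecidableEq κ]
    (T : Matrix (ι × κ) (ι × κ) ℂ) (Y : Matrix ι ι ℂ) :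
    ((Y ⊗ₖ (1 : Matrix κ κ ℂ))ᴴ * (Y ⊗ₖ (1 : Matrix κ κ ℂ)) * T).trace =
      (Yᴴ * Y * ptrace2 T).trace := by
  rw [conjTranspose_kronecker, conjTranspose_one, ← mul_kronecker_mul, Matrix.mul_one,
    trace_kronecker_one_mul]

theorem ptrace2_eq_sum (M : Matrix (ι × κ) (ι × κ) ℂ) :
    ptrace2 M = ∑ k : κ, M.submatrix (fun i => (i, k)) (fun i => (i, k)) := by
  ext i j
  simp [ptrace2, Matrix.sum_apply]

theorem trace_ptrace2 [Fintype ι] (M : Matrix (ι × κ) (ι × κ) ℂ) : (ptrace2 M).trace = M.trace := by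
  simp [trace, ptrace2, Fintype.sum_prod_type]

theorem Matrix.PosSemidef.ptrace2 {M : Matrix (ι × κ) (ι × κ) ℂ} (hM : M.PosSemidef) :
    (ptrace2 M).PosSemidef := by
  rw [ptrace2_eq_sum]
  exact posSemidef_sum _ fun k _ => hM.submatrix _

theorem Matrix.PosDef.ptrace2 [Nonempty κ] {M : Matrix (ι × κ) (ι × κ) ℂ} (hM : M.PosDef) :
    (ptrace2 M).PosDef := by
  rw [ptrace2_eq_sum]
  exact posDef_sum Finset.univ_nonempty fun k _ =>
    hM.submatrix (fun i j h => (Prod.mk.inj h).1)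

end PartialTrace

section LiebMonotonicity

theorem normSq_add_mul_parallel_le {a b : ℝ} (ha : 0 ≤ a) (hb : 0 ≤ b) (x y : ℂ) :
    Complex.normSq (x + y) * (a * b / (a + b)) ≤ Complex.normSq x * a + Complex.normSq y * b := by
  rcases eq_or_lt_of_le (add_nonneg ha hb) with h | h
  · rw [← h, div_zero, mul_zero]
    have := Complex.normSq_nonneg x
    have := Complex.normSq_nonneg y
    positivity
  · rw [← mul_div_assoc, div_le_iff₀ h]
    simp only [Complex.normSq_apply, Complex.add_re, Complex.add_im]
    nlinarith [sq_nonneg (a * x.re - b * y.re), sq_nonneg (a * x.im - b * y.im)]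

theorem exists_add_eq_parallel {a b : ℝ} (ha : 0 ≤ a) (hb : 0 ≤ b) (z : ℂ) :
    ∃ x, Complex.normSq x * a + Complex.normSq (z - x) * b
      = Complex.normSq z * (a * b / (a + b)) := by
  rcases eq_or_lt_of_le (add_nonneg ha hb) with h | h
  · have h1 : a = 0 := by linarith
    have h2 : b = 0 := by linarith
    exact ⟨0, by simp [h1, h2]⟩
  · refine ⟨((b / (a + b) : ℝ) : ℂ) * z, ?_⟩
    have h3 : z - ((b / (a + b) : ℝ) : ℂ) * z = ((a / (a + b) : ℝ) : ℂ) * z := by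
      have : ((a : ℂ) + b) ≠ 0 := by exact_mod_cast h.ne'
      push_cast
      field_simp
      ring
    rw [h3, Complex.normSq_mul, Complex.normSq_mul, Complex.normSq_ofReal, Complex.normSq_ofReal]
    field_simp
    ring

/-- The integral representation of the weighted geometric mean. -/
theorem exists_integral_parallel {t : ℝ} (ht : t ∈ Set.Ioo (0 : ℝ) 1) :
    ∃ c : ℝ, 0 < c ∧ ∀ a b : ℝ, 0 ≤ a → 0 ≤ b →
      MeasureTheory.IntegrableOn (fun l => l ^ (t - 1) * (a * b / (a + l * b))) (Set.Ioi 0) ∧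
      ∫ l in Set.Ioi (0 : ℝ), l ^ (t - 1) * (a * b / (a + l * b)) = c * (a ^ t * b ^ (1 - t)) := by
  refine ⟨_, Real.integral_rpowIntegrand₀₁_one_pos ht, fun a b ha hb => ?_⟩
  rcases eq_or_lt_of_le hb with rfl | hb
  · simp [Real.zero_rpow (sub_pos.2 ht.2).ne']
  have hx : 0 ≤ a / b := div_nonneg ha hb.le
  have h1 : Set.EqOn (fun l => b * Real.rpowIntegrand₀₁ t l (a / b))
      (fun l => l ^ (t - 1) * (a * b / (a + l * b))) (Set.Ioi 0) := by
    intro l hl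
    have hl : 0 < l := hl
    have h2 : a + l * b ≠ 0 := by positivity
    have h3 : l + a / b ≠ 0 := by positivity
    simp only [Real.rpowIntegrand₀₁_eq_pow_div ht hl.le hx]
    field_simp
    ring
  constructor
  · exact MeasureTheory.IntegrableOn.congr_fun
      ((Real.integrableOn_rpowIntegrand₀₁_Ioi ht hx).const_mul b) h1 measurableSet_Ioi
  · rw [← MeasureTheory.setIntegral_congr_fun measurableSet_Ioi h1,
      MeasureTheory.integral_const_mul, Real.integral_rpowIntegrand₀₁_eq_rpow_mul_const ht hx,
      Real.div_rpow ha hb.le, Real.rpow_sub hb, Real.rpow_one]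
    field_simp

theorem integral_sum_parallel {η : Type*} [Fintype η] {t c : ℝ}
    (hint : ∀ a b : ℝ, 0 ≤ a → 0 ≤ b →
      MeasureTheory.IntegrableOn (fun l => l ^ (t - 1) * (a * b / (a + l * b))) (Set.Ioi 0) ∧
      ∫ l in Set.Ioi (0 : ℝ), l ^ (t - 1) * (a * b / (a + l * b)) = c * (a ^ t * b ^ (1 - t)))
    (k : η → η → ℝ) {d e : η → ℝ} (hd : ∀ i, 0 ≤ d i) (he : ∀ i, 0 ≤ e i) :
    MeasureTheory.IntegrableOn (fun l : ℝ => l ^ (t - 1) *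
        ∑ i, ∑ j, k i j * (d i * e j / (d i + l * e j))) (Set.Ioi 0) ∧
      ∫ l in Set.Ioi (0 : ℝ), l ^ (t - 1) *
        ∑ i, ∑ j, k i j * (d i * e j / (d i + l * e j)) =
        c * ∑ i, ∑ j, k i j * (d i ^ t * e j ^ (1 - t)) := by
  have h1 : (fun l : ℝ => l ^ (t - 1) * ∑ i, ∑ j, k i j * (d i * e j / (d i + l * e j))) =
      fun l => ∑ i, ∑ j, k i j * (l ^ (t - 1) * (d i * e j / (d i + l * e j))) := by
    funext l
    simp only [Finset.mul_sum]
    exact Finset.sum_congr rfl fun i _ => Finset.sum_congr rfl fun j _ => by ring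
  have h2 : ∀ i j, MeasureTheory.IntegrableOn (fun l : ℝ => k i j *
      (l ^ (t - 1) * (d i * e j / (d i + l * e j)))) (Set.Ioi 0) := fun i j =>
    (hint (d i) (e j) (hd i) (he j)).1.const_mul _
  have h3 : ∀ i, MeasureTheory.IntegrableOn (fun l : ℝ => ∑ j, k i j *
      (l ^ (t - 1) * (d i * e j / (d i + l * e j)))) (Set.Ioi 0) := fun i =>
    MeasureTheory.integrable_finsetSum _ fun j _ => h2 i j
  rw [h1]
  refine ⟨MeasureTheory.integrable_finsetSum _ fun i _ => h3 i, ?_⟩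
  rw [MeasureTheory.integral_finsetSum _ fun i _ => h3 i, Finset.mul_sum]
  refine Finset.sum_congr rfl fun i _ => ?_
  rw [MeasureTheory.integral_finsetSum _ fun j _ => h2 i j, Finset.mul_sum]
  refine Finset.sum_congr rfl fun j _ => ?_
  rw [MeasureTheory.integral_const_mul, (hint (d i) (e j) (hd i) (he j)).2]
  ring

variable {ι κ : Type*} [Fintype ι] [DecidableEq ι] [Fintype κ] [DecidableEq κ]

namespace Diagonalizes

variable {A B V W : Matrix ι ι ℂ} {d e : ι → ℝ}

theorem re_trace_overlap (h : Diagonalizes V d A) (h' : Diagonalizes W e B) (K : Matrix ι ι ℂ) :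
    (Kᴴ * A * K * B).trace.re =
      ∑ i, ∑ j, Complex.normSq ((Vᴴ * K * W) i j) * (d i * e j) := by
  rw [h.trace_overlap h', Complex.ofReal_re]

theorem parallel_le (h : Diagonalizes V d A) (h' : Diagonalizes W e B) (hd : ∀ i, 0 ≤ d i)
    (he : ∀ i, 0 ≤ e i) {l : ℝ} (hl : 0 < l) (X Y : Matrix ι ι ℂ) :
    l * ∑ i, ∑ j, Complex.normSq ((Vᴴ * (X + Y) * W) i j) * (d i * e j / (d i + l * e j)) ≤
      (Xᴴ * A * X * 1).trace.re + l * (Yᴴ * 1 * Y * B).trace.re := by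
  rw [h.re_trace_overlap h'.one, h.one.re_trace_overlap h', Finset.mul_sum, Finset.mul_sum,
    ← Finset.sum_add_distrib]
  refine Finset.sum_le_sum fun i _ => ?_
  rw [Finset.mul_sum, Finset.mul_sum, ← Finset.sum_add_distrib]
  refine Finset.sum_le_sum fun j _ => ?_
  have h1 := normSq_add_mul_parallel_le (hd i) (mul_nonneg hl.le (he j))
    ((Vᴴ * X * W) i j) ((Vᴴ * Y * W) i j)
  rw [Matrix.mul_add, Matrix.add_mul, Matrix.add_apply]
  calc _ = _ := ?_
    _ ≤ _ := h1
    _ = _ := ?_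
  · rw [show d i * (l * e j) / (d i + l * e j) = l * (d i * e j / (d i + l * e j)) by ring]
    ring
  · ring

theorem exists_parallel_eq (h : Diagonalizes V d A) (h' : Diagonalizes W e B)
    (hd : ∀ i, 0 ≤ d i) (he : ∀ i, 0 ≤ e i) {l : ℝ} (hl : 0 < l) (K : Matrix ι ι ℂ) :
    ∃ X Y, X + Y = K ∧ (Xᴴ * A * X * 1).trace.re + l * (Yᴴ * 1 * Y * B).trace.re =
      l * ∑ i, ∑ j, Complex.normSq ((Vᴴ * K * W) i j) * (d i * e j / (d i + l * e j)) := by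
  choose x hx using fun i j => exists_add_eq_parallel (hd i) (mul_nonneg hl.le (he j))
    ((Vᴴ * K * W) i j)
  have hinv : ∀ Z : Matrix ι ι ℂ, Vᴴ * (V * Z * Wᴴ) * W = Z := fun Z => by
    calc Vᴴ * (V * Z * Wᴴ) * W = (Vᴴ * V) * Z * (Wᴴ * W) := by simp only [Matrix.mul_assoc]
      _ = Z := by rw [h.star_mul, h'.star_mul, Matrix.one_mul, Matrix.mul_one]
  refine ⟨V * of x * Wᴴ, K - V * of x * Wᴴ, by abel, ?_⟩
  rw [h.re_trace_overlap h'.one, h.one.re_trace_overlap h', Finset.mul_sum, Finset.mul_sum,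
    ← Finset.sum_add_distrib]
  refine Finset.sum_congr rfl fun i _ => ?_
  rw [Finset.mul_sum, Finset.mul_sum, ← Finset.sum_add_distrib]
  refine Finset.sum_congr rfl fun j _ => ?_
  rw [Matrix.mul_sub, Matrix.sub_mul, hinv, Matrix.sub_apply, of_apply]
  calc _ = _ := ?_
    _ = _ := hx i j
    _ = _ := ?_
  · ring
  · rw [show d i * (l * e j) / (d i + l * e j) = l * (d i * e j / (d i + l * e j)) by ring]
    ring

end Diagonalizes

/-- Monotonicity under partial trace of the Lieb functional `tr(K* σ ^ t K T ^ (1 - t))`. -/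
theorem lieb_monotone_ptrace2 {σ T : Matrix (ι × κ) (ι × κ) ℂ} (hσ : σ.PosSemidef)
    (hT : T.PosSemidef) {t : ℝ} (ht : t ∈ Set.Ioo (0 : ℝ) 1) (K : Matrix ι ι ℂ) :
    ((K ⊗ₖ (1 : Matrix κ κ ℂ))ᴴ * mpow σ t * (K ⊗ₖ (1 : Matrix κ κ ℂ)) *
        mpow T (1 - t)).trace.re ≤
      (Kᴴ * mpow (ptrace2 σ) t * K * mpow (ptrace2 T) (1 - t)).trace.re := by
  obtain ⟨V, d, h, hd⟩ := hσ.exists_diagonalizes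
  obtain ⟨W, e, h', he⟩ := hT.exists_diagonalizes
  obtain ⟨V', d', g, hd'⟩ := hσ.ptrace2.exists_diagonalizes
  obtain ⟨W', e', g', he'⟩ := hT.ptrace2.exists_diagonalizes
  obtain ⟨c, hc, hint⟩ := exists_integral_parallel ht
  rw [(h.mpow t).re_trace_overlap (h'.mpow _), (g.mpow t).re_trace_overlap (g'.mpow _)]
  obtain ⟨i1, e1⟩ := integral_sum_parallel hint
    (fun i j => Complex.normSq ((Vᴴ * (K ⊗ₖ (1 : Matrix κ κ ℂ)) * W) i j)) hd he
  obtain ⟨i2, e2⟩ := integral_sum_parallel hint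
    (fun i j => Complex.normSq ((V'ᴴ * K * W') i j)) hd' he'
  refine le_of_mul_le_mul_left ?_ hc
  rw [← e1, ← e2]
  refine MeasureTheory.setIntegral_mono_on i1 i2 measurableSet_Ioi fun l hl => ?_
  have hl : 0 < l := hl
  refine mul_le_mul_of_nonneg_left ?_ (Real.rpow_nonneg hl.le _)
  refine le_of_mul_le_mul_left ?_ hl
  obtain ⟨X, Y, hXY, hcost⟩ := g.exists_parallel_eq g' hd' he' hl K
  have h4 := h.parallel_le h' hd he hl (X ⊗ₖ (1 : Matrix κ κ ℂ)) (Y ⊗ₖ (1 : Matrix κ κ ℂ))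
  rw [← add_kronecker, hXY] at h4
  refine h4.trans (le_of_eq ?_)
  rw [← hcost]
  simp only [Matrix.mul_one, trace_kronecker_one_cost_left, trace_kronecker_one_cost_right]

end LiebMonotonicity

section DataProcessing

theorem Matrix.PosSemidef.mul_mul_same {ι : Type*} [Fintype ι] {A B : Matrix ι ι ℂ}
    (hA : A.PosSemidef) (hB : B.IsHermitian) : (B * A * B).PosSemidef := by
  have := hA.mul_mul_conjTranspose_same B
  rwa [hB.eq] at this

variable {ι κ : Type*} [Fintype ι] [DecidableEq ι] [Fintype κ] [DecidableEq κ]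

theorem Matrix.PosDef.mul_mul_same {A B : Matrix ι ι ℂ} (hA : A.PosDef) (hB : B.PosDef) :
    (B * A * B).PosDef := by
  have h : (B * A * B).PosSemidef := by
    have := hA.posSemidef.mul_mul_conjTranspose_same B
    rwa [hB.isHermitian.eq] at this
  exact h.posDef_iff_isUnit.2 ((hB.isUnit.mul hA.isUnit).mul hB.isUnit)

/-- Young's inequality for traces. -/
theorem re_trace_mul_mpow_le {Q R : Matrix ι ι ℂ} (hQ : Q.PosSemidef) (hR : R.PosSemidef)
    {t : ℝ} (ht : t ∈ Set.Ioo (0 : ℝ) 1) :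
    (Q * mpow R (1 - t)).trace.re ≤
      t * (mpow Q t⁻¹).trace.re + (1 - t) * R.trace.re := by
  obtain ⟨V, d, h, hd⟩ := hQ.exists_diagonalizes
  obtain ⟨W, e, h', he⟩ := hR.exists_diagonalizes
  have h1 := h.re_trace_overlap (h'.mpow (1 - t)) 1
  have h2 := (h.mpow t⁻¹).re_trace_overlap h'.one 1
  have h3 := h.one.re_trace_overlap h' 1
  simp only [conjTranspose_one, Matrix.mul_one, Matrix.one_mul] at h1 h2 h3
  rw [h1, h2, h3, Finset.mul_sum, Finset.mul_sum, ← Finset.sum_add_distrib]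
  refine Finset.sum_le_sum fun i _ => ?_
  rw [Finset.mul_sum, Finset.mul_sum, ← Finset.sum_add_distrib]
  refine Finset.sum_le_sum fun j _ => ?_
  have h4 := Real.geom_mean_le_arith_mean2_weighted ht.1.le (sub_nonneg.2 ht.2.le)
    (Real.rpow_nonneg (hd i) t⁻¹) (he j) (by ring)
  rw [← Real.rpow_mul (hd i), inv_mul_cancel₀ ht.1.ne', Real.rpow_one] at h4
  have h5 := mul_le_mul_of_nonneg_left h4 (Complex.normSq_nonneg ((Vᴴ * W) i j))
  linarith

theorem re_trace_mpow_le {M N : Matrix ι ι ℂ} (hM : M.PosSemidef) (hN : N.PosDef)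
    {α : ℝ} (hα : α ∈ Set.Ioo (0 : ℝ) 1) :
    (mpow M α).trace.re ≤
      α * (M * mpow N (-1)).trace.re + (1 - α) * (mpow N (α / (1 - α))).trace.re := by
  obtain ⟨V, d, h, hd⟩ := hM.exists_diagonalizes
  obtain ⟨W, e, h', he⟩ := hN.exists_diagonalizes
  have h1 := (h.mpow α).re_trace_overlap h'.one 1
  have h2 := h.re_trace_overlap (h'.mpow (-1)) 1
  have h3 := h.one.re_trace_overlap (h'.mpow (α / (1 - α))) 1
  simp only [conjTranspose_one, Matrix.mul_one, Matrix.one_mul] at h1 h2 h3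
  rw [h1, h2, h3, Finset.mul_sum, Finset.mul_sum, ← Finset.sum_add_distrib]
  refine Finset.sum_le_sum fun i _ => ?_
  rw [Finset.mul_sum, Finset.mul_sum, ← Finset.sum_add_distrib]
  refine Finset.sum_le_sum fun j _ => ?_
  have h0 : 0 < 1 - α := sub_pos.2 hα.2
  have h4 := Real.geom_mean_le_arith_mean2_weighted hα.1.le h0.le
    (mul_nonneg (hd i) (Real.rpow_nonneg (he j).le (-1)))
    (Real.rpow_nonneg (he j).le (α / (1 - α))) (by ring)
  rw [← Real.rpow_mul (he j).le, div_mul_cancel₀ _ h0.ne',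
    Real.mul_rpow (hd i) (Real.rpow_nonneg (he j).le _), ← Real.rpow_mul (he j).le, mul_assoc,
    ← Real.rpow_add (he j), neg_one_mul, neg_add_cancel, Real.rpow_zero] at h4
  have h5 := mul_le_mul_of_nonneg_left h4 (Complex.normSq_nonneg ((Vᴴ * W) i j))
  linarith

/-- Monotonicity of `tr((K* σ ^ (1 / p) K) ^ p)` under partial trace. -/
theorem re_trace_mpow_conj_le {σ : Matrix (ι × κ) (ι × κ) ℂ} (hσ : σ.PosSemidef)
    (K : Matrix ι ι ℂ) {p : ℝ} (hp : 1 ≤ p) :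
    (mpow ((K ⊗ₖ (1 : Matrix κ κ ℂ))ᴴ * mpow σ p⁻¹ * (K ⊗ₖ (1 : Matrix κ κ ℂ))) p).trace.re ≤
      (mpow (Kᴴ * mpow (ptrace2 σ) p⁻¹ * K) p).trace.re := by
  have hP := (hσ.mpow p⁻¹).conjTranspose_mul_mul_same (K ⊗ₖ (1 : Matrix κ κ ℂ))
  have hQ := (hσ.ptrace2.mpow p⁻¹).conjTranspose_mul_mul_same K
  rcases eq_or_lt_of_le hp with rfl | hp
  · rw [mpow_one hP.isHermitian, mpow_one hQ.isHermitian, inv_one, mpow_one hσ.isHermitian,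
      mpow_one hσ.ptrace2.isHermitian, trace_kronecker_one_cost_left]
  have hp0 : 0 < p := by linarith
  have ht : p⁻¹ ∈ Set.Ioo (0 : ℝ) 1 := ⟨inv_pos.2 hp0, inv_lt_one_of_one_lt₀ hp⟩
  set P := (K ⊗ₖ (1 : Matrix κ κ ℂ))ᴴ * mpow σ p⁻¹ * (K ⊗ₖ (1 : Matrix κ κ ℂ)) with hPdef
  have h1 := lieb_monotone_ptrace2 hσ (hP.mpow p) ht K
  rw [← hPdef, mpow_mpow hP, mul_sub, mul_one, mul_inv_cancel₀ hp0.ne'] at h1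
  have h2 : P * mpow P (p - 1) = mpow P p := by
    conv_lhs => enter [1]; rw [← mpow_one hP.isHermitian]
    rw [mpow_mul_mpow_of_nonneg hP zero_le_one (by linarith), add_sub_cancel]
  rw [h2] at h1
  have h3 := re_trace_mul_mpow_le hQ (hP.mpow p).ptrace2 ht
  rw [trace_ptrace2, inv_inv] at h3
  have h4 : p⁻¹ * (mpow P p).trace.re ≤
      p⁻¹ * (mpow (Kᴴ * mpow (ptrace2 σ) p⁻¹ * K) p).trace.re := by linarith
  exact le_of_mul_le_mul_left h4 ht.1

theorem aFid_le_ptrace2_of_posDef [Nonempty κ] {ρ σ : Matrix (ι × κ) (ι × κ) ℂ}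
    (hρ : ρ.PosDef) (hσ : σ.PosDef) {α : ℝ} (hα : 1 / 2 ≤ α) (hα' : α < 1) :
    aFid α ρ σ ≤ aFid α (ptrace2 ρ) (ptrace2 σ) := by
  have h0 : 0 < α := by linarith
  have h1 : 0 < 1 - α := by linarith
  have hI : α ∈ Set.Ioo (0 : ℝ) 1 := ⟨h0, hα'⟩
  have hp : 1 ≤ α / (1 - α) := by rw [le_div_iff₀ h1]; linarith
  unfold aFid
  set s := (1 - α) / (2 * α) with hs
  have hss : s + s = (α / (1 - α))⁻¹ := by rw [hs, inv_div]; field_simp; ring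
  set p := α / (1 - α) with hpdef
  set A := ptrace2 σ with hA
  have hApd : A.PosDef := hσ.ptrace2
  have hM := hρ.ptrace2.mul_mul_same (hApd.mpow s)
  set M := mpow A s * ptrace2 ρ * mpow A s with hMdef
  have hN := hM.mpow (1 - α)
  set N := mpow M (1 - α) with hNdef
  have hL := hN.mul_mul_same (hApd.mpow (-s))
  set L := mpow A (-s) * N * mpow A (-s) with hLdef
  set Li := mpow A s * mpow N (-1) * mpow A s with hLidef
  have hK := hL.mpow (1 / 2)
  set K := mpow L (1 / 2) with hKdef
  have hKK : K * Kᴴ = L := by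
    rw [hK.isHermitian.eq, hKdef, mpow_mul_mpow hL, add_halves, mpow_one hL.isHermitian]
  have hLLi : L * Li = 1 := by
    calc L * Li = mpow A (-s) * N * (mpow A (-s) * mpow A s) * mpow N (-1) * mpow A s := by
          rw [hLdef, hLidef]; simp only [Matrix.mul_assoc]
      _ = mpow A (-s) * (N * mpow N (-1)) * mpow A s := by
          rw [mpow_neg_mul_mpow hApd, Matrix.mul_one, Matrix.mul_assoc (mpow A (-s))]
      _ = 1 := by
          have := mpow_mul_mpow_neg hN 1
          rw [mpow_one hN.isHermitian] at this
          rw [this, Matrix.mul_one, mpow_neg_mul_mpow hApd]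
  have hNA : mpow A s * L * mpow A s = N := by
    calc mpow A s * L * mpow A s
        = (mpow A s * mpow A (-s)) * N * (mpow A (-s) * mpow A s) := by
          rw [hLdef]; simp only [Matrix.mul_assoc]
      _ = N := by
          rw [mpow_neg_mul_mpow hApd, mpow_mul_mpow_neg hApd, Matrix.one_mul, Matrix.mul_one]
  have hout1 : M * mpow N (-1) = mpow M α := by
    rw [hNdef, mpow_mpow hM.posSemidef]
    conv_lhs => enter [1]; rw [← mpow_one hM.isHermitian]
    rw [mpow_mul_mpow hM]
    congr 1
    ring
  have hout2 : mpow N p = mpow M α := by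
    rw [hNdef, mpow_mpow hM.posSemidef, hpdef, mul_div_cancel₀ _ h1.ne']
  have hM' := hρ.mul_mul_same (hσ.mpow s)
  have hN' : (mpow σ s * (L ⊗ₖ (1 : Matrix κ κ ℂ)) * mpow σ s).PosDef :=
    (hL.kronecker PosDef.one).mul_mul_same (hσ.mpow s)
  set N' := mpow σ s * (L ⊗ₖ (1 : Matrix κ κ ℂ)) * mpow σ s with hNeq
  have hNinv : mpow N' (-1) = mpow σ (-s) * (Li ⊗ₖ (1 : Matrix κ κ ℂ)) * mpow σ (-s) := by
    refine left_inv_eq_right_inv (a := N') ?_ ?_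
    · have := mpow_neg_mul_mpow hN' 1
      rwa [mpow_one hN'.isHermitian] at this
    · calc N' * (mpow σ (-s) * (Li ⊗ₖ (1 : Matrix κ κ ℂ)) * mpow σ (-s))
          = mpow σ s * (L ⊗ₖ (1 : Matrix κ κ ℂ)) * (mpow σ s * mpow σ (-s)) *
              (Li ⊗ₖ (1 : Matrix κ κ ℂ)) * mpow σ (-s) := by
            rw [hNeq]; simp only [Matrix.mul_assoc]
        _ = mpow σ s * ((L * Li) ⊗ₖ (1 * 1 : Matrix κ κ ℂ)) * mpow σ (-s) := by
            rw [mpow_mul_mpow_neg hσ, Matrix.mul_one, Matrix.mul_assoc (mpow σ s),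
              ← mul_kronecker_mul]
        _ = 1 := by
            rw [hLLi, Matrix.one_mul, one_kronecker_one, Matrix.mul_one, mpow_mul_mpow_neg hσ]
  have hin1 : (mpow σ s * ρ * mpow σ s * mpow N' (-1)).trace = (M * mpow N (-1)).trace := by
    calc (mpow σ s * ρ * mpow σ s * mpow N' (-1)).trace
        = (mpow σ s * ρ * (mpow σ s * mpow σ (-s)) * (Li ⊗ₖ (1 : Matrix κ κ ℂ)) *
            mpow σ (-s)).trace := by rw [hNinv]; simp only [Matrix.mul_assoc]
      _ = (mpow σ (-s) * mpow σ s * (ρ * (Li ⊗ₖ (1 : Matrix κ κ ℂ)))).trace := by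
          rw [mpow_mul_mpow_neg hσ, Matrix.mul_one, trace_mul_comm]
          simp only [Matrix.mul_assoc]
      _ = (Li * ptrace2 ρ).trace := by
          rw [mpow_neg_mul_mpow hσ, Matrix.one_mul, trace_mul_comm, trace_kronecker_one_mul]
      _ = (M * mpow N (-1)).trace := by
          rw [hLidef, hMdef, trace_mul_comm (_ * _ * _) (mpow N (-1)), Matrix.mul_assoc,
            Matrix.mul_assoc, trace_mul_comm]
          simp only [Matrix.mul_assoc]
  have hin2 : (mpow N' p).trace.re ≤ (mpow N p).trace.re := by
    have e1 : N' = (mpow σ s * (K ⊗ₖ (1 : Matrix κ κ ℂ))) *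
        (mpow σ s * (K ⊗ₖ (1 : Matrix κ κ ℂ)))ᴴ := by
      rw [conjTranspose_mul, (mpow_isHermitian σ s).eq, conjTranspose_kronecker,
        conjTranspose_one, hNeq, ← hKK, ← Matrix.one_mul (1 : Matrix κ κ ℂ),
        mul_kronecker_mul]
      simp only [Matrix.mul_assoc, Matrix.mul_one]
    have e2 : N = (mpow A s * K) * (mpow A s * K)ᴴ := by
      rw [conjTranspose_mul, (mpow_isHermitian A s).eq, ← hNA, ← hKK]
      simp only [Matrix.mul_assoc]
    rw [e1, e2, trace_mpow_conjTranspose_mul_comm, trace_mpow_conjTranspose_mul_comm]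
    have e3 := re_trace_mpow_conj_le hσ.posSemidef K hp
    rw [← hss, ← mpow_mul_mpow hσ, ← mpow_mul_mpow hσ.ptrace2] at e3
    convert e3 using 4
    · rw [conjTranspose_mul, (mpow_isHermitian σ s).eq]
      simp only [Matrix.mul_assoc]
    · rw [conjTranspose_mul, (mpow_isHermitian A s).eq]
      simp only [Matrix.mul_assoc, hA]
  have hin := re_trace_mpow_le hM'.posSemidef hN' hI
  rw [hin1, hout1] at hin
  rw [hout2] at hin2
  have := mul_le_mul_of_nonneg_left hin2 h1.le
  linarith

end DataProcessing

section Continuity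

open Filter Topology

open scoped Matrix.Norms.L2Operator in
theorem Filter.Tendsto.mpow {ι β : Type*} [Fintype ι] [DecidableEq ι] {l : Filter β}
    {f : β → Matrix ι ι ℂ} {A : Matrix ι ι ℂ} (hf : Tendsto f l (𝓝 A))
    (hfh : ∀ x, (f x).IsHermitian) (hA : A.IsHermitian) {t : ℝ} (ht : 0 < t) :
    Tendsto (fun x => mpow (f x) t) l (𝓝 (mpow A t)) := by
  have hcfc : ∀ B : Matrix ι ι ℂ, B.IsHermitian → _root_.mpow B t = cfc (fun x : ℝ => x ^ t) B := by
    intro B hB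
    rw [hB.cfc_eq, IsHermitian.cfc, _root_.mpow, dif_pos hB, Unitary.conjStarAlgAut_apply]
    rfl
  simp only [hcfc _ (hfh _), hcfc A hA]
  set r : ℝ := (‖A‖ + 1) * ‖(1 : Matrix ι ι ℂ)‖
  have hs : ∀ B : Matrix ι ι ℂ, ‖B‖ ≤ ‖A‖ + 1 → spectrum ℝ B ⊆ Metric.closedBall 0 r := fun B hB =>
    (spectrum.subset_closedBall_norm_mul B).trans
      (Metric.closedBall_subset_closedBall (mul_le_mul_of_nonneg_right hB (norm_nonneg _)))
  refine Filter.Tendsto.cfc (isCompact_closedBall (0 : ℝ) r) _ hf ?_ (Eventually.of_forall hfh)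
    (hs A (by linarith)) hA (Real.continuous_rpow_const ht.le).continuousOn
  filter_upwards [hf.norm.eventually (gt_mem_nhds (lt_add_one ‖A‖))] with x hx
  exact hs _ hx.le

theorem continuous_ptrace2 {ι κ : Type*} [Fintype κ] :
    Continuous (ptrace2 : Matrix (ι × κ) (ι × κ) ℂ → Matrix ι ι ℂ) := by
  refine continuous_matrix fun i j => ?_
  simp only [ptrace2, of_apply]
  exact continuous_finsetSum _ fun k _ => continuous_id.matrix_elem _ _

variable {ι κ : Type*} [Fintype ι] [DecidableEq ι] [Fintype κ] [DecidableEq κ]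

theorem tendsto_aFid {β : Type*} {l : Filter β} {f g : β → Matrix ι ι ℂ} {ρ σ : Matrix ι ι ℂ}
    (hf : Tendsto f l (𝓝 ρ)) (hg : Tendsto g l (𝓝 σ)) (hfh : ∀ x, (f x).IsHermitian)
    (hgh : ∀ x, (g x).IsHermitian) (hρ : ρ.IsHermitian) (hσ : σ.IsHermitian)
    {α : ℝ} (hα : 0 < α) (hα' : α < 1) :
    Tendsto (fun x => aFid α (f x) (g x)) l (𝓝 (aFid α ρ σ)) := by
  have hs : 0 < (1 - α) / (2 * α) := div_pos (by linarith) (by linarith)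
  have hconj : ∀ X Y : Matrix ι ι ℂ, X.IsHermitian → Y.IsHermitian → (Y * X * Y).IsHermitian :=
    fun X Y hX hY => by
      have := isHermitian_mul_mul_conjTranspose Y hX
      rwa [hY.eq] at this
  have h1 := hg.mpow hgh hσ hs
  have h2 := ((h1.mul hf).mul h1).mpow
    (fun x => hconj _ _ (hfh x) (mpow_isHermitian _ _)) (hconj _ _ hρ (mpow_isHermitian _ _)) hα
  have h3 : Continuous fun X : Matrix ι ι ℂ => X.trace.re :=
    Complex.continuous_re.comp (continuous_id.matrix_trace)
  exact (h3.tendsto _).comp h2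

/-- The data-processing inequality for the fidelity under partial trace. -/
theorem aFid_le_ptrace2 [Nonempty κ] {ρ σ : Matrix (ι × κ) (ι × κ) ℂ}
    (hρ : ρ.PosSemidef) (hσ : σ.PosSemidef) {α : ℝ} (hα : 1 / 2 ≤ α) (hα' : α < 1) :
    aFid α ρ σ ≤ aFid α (ptrace2 ρ) (ptrace2 σ) := by
  have h0 : 0 < α := by linarith
  have hlim : ∀ A : Matrix (ι × κ) (ι × κ) ℂ,
      Tendsto (fun k : ℕ => A + ((1 / ((k : ℝ) + 1) : ℝ) : ℂ) • (1 : Matrix (ι × κ) (ι × κ) ℂ))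
        atTop (𝓝 A) := by
    intro A
    have h1 : Tendsto (fun k : ℕ => ((1 / ((k : ℝ) + 1) : ℝ) : ℂ)) atTop (𝓝 ((0 : ℝ) : ℂ)) :=
      (Complex.continuous_ofReal.tendsto 0).comp tendsto_one_div_add_atTop_nhds_zero_nat
    simpa using tendsto_const_nhds.add (h1.smul_const (1 : Matrix (ι × κ) (ι × κ) ℂ))
  have hpd : ∀ A : Matrix (ι × κ) (ι × κ) ℂ, A.PosSemidef → ∀ k : ℕ,
      (A + ((1 / ((k : ℝ) + 1) : ℝ) : ℂ) • (1 : Matrix (ι × κ) (ι × κ) ℂ)).PosDef := by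
    intro A hA k
    obtain ⟨V, d, h, hd⟩ := hA.exists_diagonalizes
    refine (h.add (h.one.smul (1 / ((k : ℝ) + 1)))).posDef fun i => ?_
    have := hd i
    positivity
  refine le_of_tendsto_of_tendsto'
    (tendsto_aFid (hlim ρ) (hlim σ) (fun k => (hpd ρ hρ k).isHermitian)
      (fun k => (hpd σ hσ k).isHermitian) hρ.isHermitian hσ.isHermitian h0 hα')
    (tendsto_aFid ((continuous_ptrace2.tendsto _).comp (hlim ρ))
      ((continuous_ptrace2.tendsto _).comp (hlim σ))
      (fun k => (hpd ρ hρ k).posSemidef.ptrace2.isHermitian)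
      (fun k => (hpd σ hσ k).posSemidef.ptrace2.isHermitian)
      hρ.ptrace2.isHermitian hσ.ptrace2.isHermitian h0 hα')
    fun k => aFid_le_ptrace2_of_posDef (hpd ρ hρ k) (hpd σ hσ k) hα hα'

end Continuity

section Fidelity

variable {ι κ : Type*} [Fintype ι] [DecidableEq ι] [Fintype κ] [DecidableEq κ]

theorem aFid_nonneg {ρ : Matrix ι ι ℂ} (hρ : ρ.PosSemidef) (σ : Matrix ι ι ℂ) (α : ℝ) :
    0 ≤ aFid α ρ σ :=
  (Complex.nonneg_iff.1
    ((hρ.mul_mul_same (mpow_isHermitian σ ((1 - α) / (2 * α)))).mpow α).trace_nonneg).1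

theorem aFid_eq_zero_iff {ρ σ : Matrix ι ι ℂ} (hρ : ρ.PosSemidef) (hσ : σ.PosSemidef) {α : ℝ}
    (hα : 0 < α) (hα' : α < 1) : aFid α ρ σ = 0 ↔ (ρ * σ).trace = 0 := by
  have hs : 0 < (1 - α) / (2 * α) := div_pos (by linarith) (by linarith)
  unfold aFid
  set s := (1 - α) / (2 * α)
  have hM := hρ.mul_mul_same (mpow_isHermitian σ s)
  obtain ⟨Z, m, hZ, hm⟩ := hM.exists_diagonalizes
  obtain ⟨V, d, h, hd⟩ := hρ.exists_diagonalizes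
  obtain ⟨W, e, h', he⟩ := hσ.exists_diagonalizes
  have htr : (mpow σ s * ρ * mpow σ s).trace = (ρ * mpow σ (s + s)).trace := by
    rw [← mpow_mul_mpow_of_nonneg hσ hs.le hs.le, Matrix.mul_assoc, trace_mul_comm,
      Matrix.mul_assoc]
  have h1 : (mpow (mpow σ s * ρ * mpow σ s) α).trace.re = 0 ↔
      (mpow σ s * ρ * mpow σ s).trace = 0 := by
    rw [(hZ.mpow α).trace_eq, hZ.trace_eq, Complex.ofReal_re, Complex.ofReal_eq_zero,
      Finset.sum_eq_zero_iff_of_nonneg fun i _ => Real.rpow_nonneg (hm i) α,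
      Finset.sum_eq_zero_iff_of_nonneg fun i _ => hm i]
    simp only [Real.rpow_eq_zero (hm _) hα.ne']
  have h2 := h.trace_overlap h' 1
  have h3 := h.trace_overlap (h'.mpow (s + s)) 1
  simp only [conjTranspose_one, Matrix.mul_one, Matrix.one_mul] at h2 h3
  have hnn : ∀ {f : ι → ℝ}, (∀ j, 0 ≤ f j) → ∀ i j,
      0 ≤ Complex.normSq ((Vᴴ * W) i j) * (d i * f j) := fun hf i j =>
    mul_nonneg (Complex.normSq_nonneg _) (mul_nonneg (hd i) (hf j))
  have hz : ∀ {f : ι → ℝ}, (∀ j, 0 ≤ f j) →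
      (∑ i, ∑ j, Complex.normSq ((Vᴴ * W) i j) * (d i * f j) = 0 ↔
        ∀ i j, Complex.normSq ((Vᴴ * W) i j) = 0 ∨ d i = 0 ∨ f j = 0) := by
    intro f hf
    rw [Finset.sum_eq_zero_iff_of_nonneg fun i _ => Finset.sum_nonneg fun j _ => hnn hf i j]
    simp only [Finset.sum_eq_zero_iff_of_nonneg fun j _ => hnn hf _ j, Finset.mem_univ,
      true_implies, mul_eq_zero]
  rw [h1, htr, h2, h3, Complex.ofReal_eq_zero, Complex.ofReal_eq_zero, hz he,
    hz fun j => Real.rpow_nonneg (he j) _]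
  simp only [Real.rpow_eq_zero (he _) (add_pos hs hs).ne']

theorem aFid_unitary_conj {ρ σ : Matrix ι ι ℂ} (hρ : ρ.PosSemidef) (hσ : σ.PosSemidef)
    {U : Matrix ι ι ℂ} (hU : U ∈ unitaryGroup ι ℂ) (α : ℝ) :
    aFid α (U * ρ * Uᴴ) (U * σ * Uᴴ) = aFid α ρ σ := by
  have hUU : Uᴴ * U = 1 := mem_unitaryGroup_iff'.1 hU
  have hM := hρ.mul_mul_same (mpow_isHermitian σ ((1 - α) / (2 * α)))
  unfold aFid
  rw [mpow_unitary_conj hσ.isHermitian hU]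
  set S := mpow σ ((1 - α) / (2 * α))
  have h1 : U * S * Uᴴ * (U * ρ * Uᴴ) * (U * S * Uᴴ) = U * (S * ρ * S) * Uᴴ := by
    calc _ = U * S * (Uᴴ * U) * ρ * (Uᴴ * U) * S * Uᴴ := by simp only [Matrix.mul_assoc]
      _ = _ := by rw [hUU]; simp only [Matrix.mul_assoc, Matrix.one_mul]
  rw [h1, mpow_unitary_conj hM.isHermitian hU, trace_mul_comm, ← Matrix.mul_assoc, hUU,
    Matrix.one_mul]

theorem aFid_kronecker_s1 {ρ σ : Matrix ι ι ℂ} {ξ η : Matrix κ κ ℂ} (hρ : ρ.PosSemidef)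
    (hσ : σ.PosSemidef) (hξ : ξ.PosSemidef) (hη : η.PosSemidef) (α : ℝ) :
    aFid α (ρ ⊗ₖ ξ) (σ ⊗ₖ η) = aFid α ρ σ * aFid α ξ η := by
  have h1 := hρ.mul_mul_same (mpow_isHermitian σ ((1 - α) / (2 * α)))
  have h2 := hξ.mul_mul_same (mpow_isHermitian η ((1 - α) / (2 * α)))
  unfold aFid
  rw [mpow_kronecker_s1 hσ hη, ← mul_kronecker_mul, ← mul_kronecker_mul, mpow_kronecker_s1 h1 h2,
    trace_kronecker, (h1.isHermitian.diagonalizes.mpow α).trace_eq,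
    (h2.isHermitian.diagonalizes.mpow α).trace_eq, ← Complex.ofReal_mul]
  simp only [Complex.ofReal_re]

end Fidelity

/-- the data-processing inequality for induced channels in terms of the
sandwiched α-Rényi divergence. -/
theorem stmt1 {n m : ℕ} (α : ℝ) (hα : (1 : ℝ) / 2 ≤ α) (hα' : α < 1)
    (ρ₁ ρ₂ : Matrix (Fin n) (Fin n) ℂ) (hρ₁ : IsDensity ρ₁) (hρ₂ : IsDensity ρ₂)
    (hρ : (ρ₁ * ρ₂).trace ≠ 0)
    (ξ₁ ξ₂ : Matrix (Fin m) (Fin m) ℂ) (hξ₁ : IsDensity ξ₁) (hξ₂ : IsDensity ξ₂)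
    (hξ : (ξ₁ * ξ₂).trace ≠ 0)
    (U : Matrix (Fin n × Fin m) (Fin n × Fin m) ℂ)
    (hU : U ∈ Matrix.unitaryGroup (Fin n × Fin m) ℂ)
    (E₁ E₂ : Matrix (Fin n) (Fin n) ℂ → Matrix (Fin n) (Fin n) ℂ)
    (hE₁ : ∀ ρ, E₁ ρ = ptrace2 (U * (ρ ⊗ₖ ξ₁) * Uᴴ))
    (hE₂ : ∀ ρ, E₂ ρ = ptrace2 (U * (ρ ⊗ₖ ξ₂) * Uᴴ)) :
    (E₁ ρ₁ * E₂ ρ₂).trace ≠ 0 ∧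
      renyiDiv α (E₁ ρ₁) (E₂ ρ₂) - renyiDiv α ρ₁ ρ₂ ≤ renyiDiv α ξ₁ ξ₂ := by
  have h0 : 0 < α := by linarith
  have hm : Nonempty (Fin m) := by
    by_contra hne
    rw [not_nonempty_iff] at hne
    have h1 := hξ₁.2
    simp [trace] at h1
  have hP₁ := (hρ₁.1.kronecker hξ₁.1).mul_mul_conjTranspose_same U
  have hP₂ := (hρ₂.1.kronecker hξ₂.1).mul_mul_conjTranspose_same U
  have hF := aFid_le_ptrace2 hP₁ hP₂ hα hα'
  rw [aFid_unitary_conj (hρ₁.1.kronecker hξ₁.1) (hρ₂.1.kronecker hξ₂.1) hU,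
    aFid_kronecker_s1 hρ₁.1 hρ₂.1 hξ₁.1 hξ₂.1, ← hE₁, ← hE₂] at hF
  have hFρ : 0 < aFid α ρ₁ ρ₂ := (aFid_nonneg hρ₁.1 ρ₂ α).lt_of_ne' fun h =>
    hρ ((aFid_eq_zero_iff hρ₁.1 hρ₂.1 h0 hα').1 h)
  have hFξ : 0 < aFid α ξ₁ ξ₂ := (aFid_nonneg hξ₁.1 ξ₂ α).lt_of_ne' fun h =>
    hξ ((aFid_eq_zero_iff hξ₁.1 hξ₂.1 h0 hα').1 h)
  have hout : 0 < aFid α (E₁ ρ₁) (E₂ ρ₂) := (mul_pos hFρ hFξ).trans_le hF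
  constructor
  · intro h
    refine hout.ne' ((aFid_eq_zero_iff ?_ ?_ h0 hα').2 h)
    · rw [hE₁]; exact hP₁.ptrace2
    · rw [hE₂]; exact hP₂.ptrace2
  · have hlog := Real.log_le_log (mul_pos hFρ hFξ) hF
    rw [Real.log_mul hFρ.ne' hFξ.ne'] at hlog
    have hneg : 1 / (α - 1) ≤ 0 := div_nonpos_of_nonneg_of_nonpos zero_le_one (by linarith)
    have h1 := mul_le_mul_of_nonpos_left hlog hneg
    unfold renyiDiv
    linarith
end
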